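/- arXiv:2401.15388 — 2 statements merged into one kernel-verified Lean document; each statement's English description precedes it below -/
import Mathlib

section
/- Let E, F ⊆ ℝ be closed, A, M ⊆ ℝ measurable with |A| = 0 and M having everywhere positive measure, let ε > 0, and let H be a closed set with F ⊆ H ⊆ (F ∪ M) ∩ (F)_ε that meets the middle third of every component of F̂^c ∩ (F)_ε in positive measure. Then there is a nondecreasing absolutely continuous function g: ℝ → [0, ε] such that: (i) supp(g') ⊆ H; (ii) Lip g(x) < ∞ for every x ∈ ℝ; (iii) g'(x) = 1 for every x ∈ A ∩ F ∩ E^c; (iv) osc(g, U) ≤ ε|U| whenever U is an interval meeting E; and (v) ‖g'‖_{L¹} < ε. -/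
open Filter MeasureTheory Set Metric Topology

noncomputable def lipInf (f : ℝ → ℝ) (x : ℝ) : ENNReal :=
  Filter.liminf
    (fun r : ℝ => ⨆ y ∈ Metric.ball x r, ENNReal.ofReal (|f y - f x| / r))
    (nhdsWithin 0 (Set.Ioi (0:ℝ)))

noncomputable def lipSup (f : ℝ → ℝ) (x : ℝ) : ENNReal :=
  Filter.limsup
    (fun r : ℝ => ⨆ y ∈ Metric.ball x r, ENNReal.ofReal (|f y - f x| / r))
    (nhdsWithin 0 (Set.Ioi (0:ℝ)))

/-- Absolute continuity of `f` on all of `ℝ`. -/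
def AbsCont (f : ℝ → ℝ) : Prop :=
  ∀ ε > (0:ℝ), ∃ δ > (0:ℝ), ∀ (n : ℕ) (a b : Fin n → ℝ),
    (∀ i, a i ≤ b i) →
    (Pairwise fun i j => Disjoint (Set.Ioo (a i) (b i)) (Set.Ioo (a j) (b j))) →
    (∑ i, (b i - a i)) < δ → (∑ i, |f (b i) - f (a i)|) < ε

/-- `M` has everywhere positive (Lebesgue) measure. -/
def EPM (M : Set ℝ) : Prop :=
  ∀ a b : ℝ, a < b → 0 < MeasureTheory.volume (M ∩ Set.Ioo a b)

noncomputable def Fhat (F : Set ℝ) : Set ℝ :=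
  F ∪ ⋃ n : ℕ, {x : ℝ | Metric.infDist x F = 1 / (n + 1)}

/-- A finite measure absolutely continuous with respect to Lebesgue measure is uniformly small on
sets of small Lebesgue measure. -/
lemma exists_pos_measure_lt_of_volume_lt (ν : Measure ℝ) [IsFiniteMeasure ν] (hν : ν ≪ volume)
    {η : ENNReal} (hη : η ≠ 0) : ∃ δ > 0, ∀ s, MeasurableSet s → volume s < δ → ν s < η := by
  have h : ∫⁻ x, ν.rnDeriv volume x ≠ ⊤ := (Measure.lintegral_rnDeriv_lt_top ν volume).ne
  obtain ⟨δ, hδ, H⟩ := exists_pos_setLIntegral_lt_of_measure_lt h hη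
  refine ⟨δ, hδ, fun s hs hsδ => ?_⟩
  have := H s hsδ
  rwa [← withDensity_apply _ hs, Measure.withDensity_rnDeriv_eq _ _ hν] at this

lemma measureReal_Iic_sub (ν : Measure ℝ) [IsFiniteMeasure ν] {a b : ℝ} (hab : a ≤ b) :
    ν.real (Iic b) - ν.real (Iic a) = ν.real (Ioc a b) := by
  rw [← Iic_sdiff_Iic, measureReal_sdiff (Iic_subset_Iic.2 hab) measurableSet_Iic]

lemma monotone_measureReal_Iic (ν : Measure ℝ) [IsFiniteMeasure ν] :
    Monotone fun x => ν.real (Iic x) :=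
  fun _ _ h => measureReal_mono (Iic_subset_Iic.2 h)

lemma absCont_measureReal_Iic (ν : Measure ℝ) [IsFiniteMeasure ν] (hν : ν ≪ volume) :
    AbsCont fun x => ν.real (Iic x) := by
  intro η hη
  obtain ⟨δ, hδ, H⟩ := exists_pos_measure_lt_of_volume_lt ν hν (ENNReal.ofReal_pos.2 hη).ne'
  obtain ⟨δ', hδ'0, hδ'⟩ : ∃ δ' : ℝ, 0 < δ' ∧ ENNReal.ofReal δ' ≤ δ := by
    rcases eq_or_ne δ ⊤ with rfl | h
    · exact ⟨1, one_pos, le_top⟩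
    · exact ⟨δ.toReal, ENNReal.toReal_pos hδ.ne' h, ENNReal.ofReal_toReal_le⟩
  refine ⟨δ', hδ'0, fun n a b hab hdisj hsum => ?_⟩
  have key : ∀ i, |ν.real (Iic (b i)) - ν.real (Iic (a i))| = ν.real (Ioo (a i) (b i)) := by
    intro i
    rw [measureReal_Iic_sub ν (hab i), abs_of_nonneg measureReal_nonneg]
    exact measureReal_congr (hν.ae_eq Ioo_ae_eq_Ioc.symm)
  simp only [key]
  rw [← measureReal_biUnion_finset (fun i _ j _ hij => hdisj hij) (fun _ _ => measurableSet_Ioo)]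
  have hm : MeasurableSet (⋃ i ∈ (Finset.univ : Finset (Fin n)), Ioo (a i) (b i)) :=
    Finset.measurableSet_biUnion _ fun _ _ => measurableSet_Ioo
  have hv : volume (⋃ i ∈ (Finset.univ : Finset (Fin n)), Ioo (a i) (b i)) < δ := by
    refine lt_of_le_of_lt (measure_biUnion_finset_le _ _) (lt_of_lt_of_le ?_ hδ')
    simp only [Real.volume_Ioo]
    rw [← ENNReal.ofReal_sum_of_nonneg fun i _ => sub_nonneg.2 (hab i)]
    exact (ENNReal.ofReal_lt_ofReal_iff hδ'0).2 hsum
  exact (ENNReal.lt_ofReal_iff_toReal_lt (measure_ne_top _ _)).1 (H _ hm hv)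

lemma AbsCont.continuous {f : ℝ → ℝ} (hf : AbsCont f) : Continuous f := by
  rw [Metric.continuous_iff]
  intro x η hη
  obtain ⟨δ, hδ, H⟩ := hf η hη
  refine ⟨δ, hδ, fun y hy => ?_⟩
  rw [Real.dist_eq] at hy ⊢
  have := H 1 (fun _ => min x y) (fun _ => max x y) (fun _ => min_le_max)
    (fun i j hij => absurd (Subsingleton.elim i j) hij)
    (by simpa [max_sub_min_eq_abs] using hy)
  simp only [Finset.univ_unique, Finset.sum_const, Finset.card_singleton, one_smul] at this
  rcases le_total x y with h | h
  · simpa [h] using this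
  · simpa [h, abs_sub_comm] using this

/-- The distribution function of an absolutely continuous finite measure has an integrable
derivative, whose `L¹` norm is at most the total mass. -/
lemma integrable_deriv_measureReal_Iic (ν : Measure ℝ) [IsFiniteMeasure ν] (hν : ν ≪ volume) :
    Integrable (deriv fun x => ν.real (Iic x)) ∧
      ∫ x, |deriv (fun x => ν.real (Iic x)) x| ≤ ν.real univ := by
  let f : StieltjesFunction ℝ :=
    { toFun := fun x => ν.real (Iic x)
      mono' := monotone_measureReal_Iic ν
      right_continuous' := fun x =>
        (absCont_measureReal_Iic ν hν).continuous.continuousAt.continuousWithinAt }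
  have hf : f.measure = ν := by
    refine (Measure.ext_of_Ioc ν f.measure fun a b hab => ?_).symm
    rw [f.measure_Ioc]
    change _ = ENNReal.ofReal (ν.real (Iic b) - ν.real (Iic a))
    rw [measureReal_Iic_sub ν hab.le, ofReal_measureReal]
  have hae : deriv (fun x => ν.real (Iic x)) =ᵐ[volume] fun x => (ν.rnDeriv volume x).toReal := by
    filter_upwards [f.ae_hasDerivAt] with x hx
    rw [hf] at hx
    exact hx.deriv
  have hint : Integrable fun x => (ν.rnDeriv volume x).toReal := Measure.integrable_toReal_rnDeriv
  refine ⟨hint.congr hae.symm, ?_⟩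
  have : ∫ x, |deriv (fun x => ν.real (Iic x)) x| = ∫ x, (ν.rnDeriv volume x).toReal := by
    refine integral_congr_ae ?_
    filter_upwards [hae] with x hx
    rw [hx, abs_of_nonneg ENNReal.toReal_nonneg]
  rw [this, Measure.integral_toReal_rnDeriv hν]

/-- A null set can be covered, away from a closed set `E`, by an open set disjoint from `E` which
is small both in measure and relative to every interval meeting `E`. -/
lemma exists_isOpen_small_near {A E : Set ℝ} (hA : volume A = 0) (hE : IsClosed E)
    {η : ℝ} (hη : 0 < η) :
    ∃ G : Set ℝ, IsOpen G ∧ A \ E ⊆ G ∧ Disjoint G E ∧ volume G ≤ ENNReal.ofReal η ∧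
      ∀ a b : ℝ, (Ioo a b ∩ E).Nonempty →
        volume (G ∩ Ioo a b) ≤ ENNReal.ofReal (η * (b - a)) := by
  have hG : ∀ n : ℕ, ∃ U : Set ℝ, A ⊆ U ∧ IsOpen U ∧
      volume U ≤ ENNReal.ofReal (η * (1 / 2) ^ (n + 1) * (1 / (n + 1))) := by
    intro n
    have hpos : ENNReal.ofReal (η * (1 / 2) ^ (n + 1) * (1 / (n + 1))) ≠ 0 :=
      (ENNReal.ofReal_pos.2 (by positivity)).ne'
    obtain ⟨U, hAU, hU, hlt⟩ := A.exists_isOpen_lt_of_lt _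
      (by rw [hA]; exact pos_iff_ne_zero.2 hpos)
    exact ⟨U, hAU, hU, hlt.le⟩
  choose U hAU hUo hUv using hG
  have hsum : ∑' n : ℕ, ENNReal.ofReal (η * (1 / 2) ^ (n + 1)) = ENNReal.ofReal η := by
    have h2 : HasSum (fun n : ℕ => η * (1 / 2 : ℝ) ^ (n + 1)) η := by
      have h1 := hasSum_geometric_two.mul_left (η * (1 / 2))
      have h2 : (fun n : ℕ => η * (1 / 2 : ℝ) ^ (n + 1)) = fun n => η * (1 / 2) * (1 / 2) ^ n := by
        funext n
        ring
      rwa [h2, show η = η * (1 / 2) * 2 by ring,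
        show η * (1 / 2) * 2 * (1 / 2) = η * (1 / 2) by ring]
    rw [← ENNReal.ofReal_tsum_of_nonneg (fun n => by positivity) h2.summable, h2.tsum_eq]
  have hle : ∀ n : ℕ, ∀ t : ℝ, 1 / ((n : ℝ) + 1) ≤ t →
      volume (U n) ≤ ENNReal.ofReal (η * (1 / 2) ^ (n + 1)) * ENNReal.ofReal t := by
    intro n t ht
    rw [← ENNReal.ofReal_mul (by positivity)]
    exact (hUv n).trans (ENNReal.ofReal_le_ofReal (by gcongr))
  refine ⟨⋃ n : ℕ, U n ∩ (cthickening (1 / ((n : ℝ) + 1)) E)ᶜ, ?_, ?_, ?_, ?_, ?_⟩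
  · exact isOpen_iUnion fun n => (hUo n).inter isClosed_cthickening.isOpen_compl
  · rintro x ⟨hxA, hxE⟩
    have : ∃ δ > 0, x ∉ cthickening δ E := by
      by_contra! h
      apply hxE
      have hmem : x ∈ ⋂ (δ : ℝ) (_ : 0 < δ), cthickening δ E := by simpa using h
      rwa [← closure_eq_iInter_cthickening, hE.closure_eq] at hmem
    obtain ⟨δ, hδ, hx⟩ := this
    obtain ⟨n, hn⟩ := exists_nat_one_div_lt hδ
    exact mem_iUnion.2 ⟨n, hAU n hxA, fun h => hx (cthickening_mono hn.le _ h)⟩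
  · rw [disjoint_iUnion_left]
    intro n
    rw [Set.disjoint_left]
    exact fun x hx hxE => hx.2 (self_subset_cthickening _ hxE)
  · refine (measure_iUnion_le _).trans ?_
    rw [← hsum]
    refine ENNReal.tsum_le_tsum fun n => (measure_mono inter_subset_left).trans ?_
    have := hle n 1 (by rw [div_le_one (by positivity)]; linarith [n.cast_nonneg (α := ℝ)])
    simpa using this
  · rintro a b ⟨e, heI, heE⟩
    have hab : a < b := heI.1.trans heI.2
    rw [iUnion_inter, ENNReal.ofReal_mul hη.le, ← hsum, ← ENNReal.tsum_mul_right]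
    refine (measure_iUnion_le _).trans (ENNReal.tsum_le_tsum fun n => ?_)
    rcases (U n ∩ (cthickening (1 / ((n : ℝ) + 1)) E)ᶜ ∩ Ioo a b).eq_empty_or_nonempty with h | h
    · rw [h, measure_empty]
      exact zero_le
    · obtain ⟨y, ⟨-, hy⟩, hyI⟩ := h
      refine (measure_mono (inter_subset_left.trans inter_subset_left)).trans (hle n _ ?_)
      by_contra! hlt
      refine hy (mem_cthickening_of_dist_le y e _ E heE ?_)
      rw [Real.dist_eq, abs_le]
      constructor <;> linarith [heI.1, heI.2, hyI.1, hyI.2]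

lemma isClosed_Fhat {F : Set ℝ} (hF : IsClosed F) (hne : F.Nonempty) : IsClosed (Fhat F) := by
  have h : Fhat F = (fun x => infDist x F) ⁻¹'
      insert 0 (range fun n : ℕ => 1 / ((n : ℝ) + 1)) := by
    ext x
    simp only [Fhat, mem_union, mem_iUnion, mem_ofPred_eq, mem_preimage, mem_insert_iff, mem_range,
      hF.mem_iff_infDist_zero hne, eq_comm]
  rw [h]
  exact (tendsto_one_div_add_atTop_nhds_zero_nat.isCompact_insert_range).isClosed.preimage
    (continuous_infDist_pt F)

/-- On a segment missing `F`, the distance to `F` at the midpoint exceeds the smaller distance at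
the endpoints by half the length. -/
lemma add_le_infDist_of_Icc_disjoint {F : Set ℝ} (hne : F.Nonempty) {c t m : ℝ}
    (h : Disjoint (Icc (c - t) (c + t)) F) (hl : m ≤ infDist (c - t) F)
    (hr : m ≤ infDist (c + t) F) : m + t ≤ infDist c F := by
  refine (le_infDist hne).2 fun f hf => ?_
  have hfm : f < c - t ∨ c + t < f := by
    by_contra! hcon
    exact Set.disjoint_left.1 h ⟨hcon.1, hcon.2⟩ hf
  rw [Real.dist_eq]
  rcases hfm with hlt | hlt
  · have h1 := hl.trans (infDist_le_dist_of_mem hf)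
    rw [Real.dist_eq, abs_of_pos (by linarith)] at h1
    exact le_trans (by linarith) (le_abs_self _)
  · have h1 := hr.trans (infDist_le_dist_of_mem hf)
    rw [Real.dist_eq, abs_of_neg (by linarith)] at h1
    exact le_trans (by linarith) (neg_le_abs _)

/-- A ball missing `F` on which the distance to `F` lies in `[m, M]` has radius at most `M - m`. -/
lemma radius_le_of_infDist_mem_Icc {F : Set ℝ} (hne : F.Nonempty) {c r m M : ℝ} (hr : 0 < r)
    (hd : Disjoint (ball c r) F) (h : ∀ z ∈ ball c r, infDist z F ∈ Icc m M) : r ≤ M - m := by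
  refine le_of_forall_lt_imp_le_of_dense fun t ht => ?_
  rcases lt_or_ge t 0 with h0 | h0
  · have := h c (mem_ball_self hr)
    linarith [this.1, this.2]
  have hsub : Icc (c - t) (c + t) ⊆ ball c r := by
    rw [Real.ball_eq_Ioo]
    exact Icc_subset_Ioo (by linarith) (by linarith)
  have := add_le_infDist_of_Icc_disjoint hne (hd.mono_left hsub)
    (h _ (hsub ⟨le_rfl, by linarith⟩)).1 (h _ (hsub ⟨by linarith, le_rfl⟩)).1
  linarith [(h c (mem_ball_self hr)).2]

/-- A ball missing `Fhat F` is quadratically small compared with its distance to `F`. -/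
lemma two_mul_radius_le_sq {F : Set ℝ} (hF : IsClosed F) (hne : F.Nonempty) {c r y : ℝ}
    (hr : 0 < r) (hB : ball c r ⊆ (Fhat F)ᶜ) (hy : y ∈ ball c r) (hy1 : infDist y F < 1) :
    2 * r ≤ 4 * infDist y F ^ 2 := by
  have hdisj : Disjoint (ball c r) F :=
    Set.disjoint_left.2 fun z hz hzF => hB hz (Or.inl hzF)
  have hlev : ∀ z ∈ ball c r, ∀ n : ℕ, infDist z F ≠ 1 / (n + 1) :=
    fun z hz n h => hB hz (Or.inr (mem_iUnion.2 ⟨n, h⟩))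
  have hpos : 0 < infDist y F :=
    (hF.notMem_iff_infDist_pos hne).1 (Set.disjoint_left.1 hdisj hy)
  obtain ⟨n, hn1, hn2⟩ : ∃ n : ℕ, 1 / ((n : ℝ) + 1 + 1) < infDist y F ∧
      infDist y F < 1 / (n + 1) := by
    classical
    have hex := exists_nat_one_div_lt hpos
    obtain ⟨k, hk⟩ : ∃ k, Nat.find hex = k + 1 := by
      refine Nat.exists_eq_succ_of_ne_zero fun h0 => ?_
      have := Nat.find_spec hex
      rw [h0] at this
      norm_num at this
      linarith
    refine ⟨k, ?_, ?_⟩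
    · have := Nat.find_spec hex
      rw [hk] at this
      push_cast at this
      exact this
    · exact lt_of_le_of_ne (not_lt.1 (Nat.find_min hex (by omega : k < Nat.find hex)))
        (hlev y hy k)
  have hord : OrdConnected ((fun z => infDist z F) '' ball c r) :=
    ((convex_ball c r).isPreconnected.image _ (continuous_infDist_pt F).continuousOn).ordConnected
  have hrange : ∀ z ∈ ball c r, infDist z F ∈ Icc (1 / ((n : ℝ) + 1 + 1)) (1 / (n + 1)) := by
    intro z hz
    constructor
    · by_contra! h
      obtain ⟨w, hw, hw'⟩ := hord.out (mem_image_of_mem _ hz) (mem_image_of_mem _ hy) ⟨h.le, hn1.le⟩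
      exact hlev w hw (n + 1) (by push_cast; exact hw')
    · by_contra! h
      obtain ⟨w, hw, hw'⟩ := hord.out (mem_image_of_mem _ hy) (mem_image_of_mem _ hz) ⟨hn2.le, h.le⟩
      exact hlev w hw n hw'
  have hrle := radius_le_of_infDist_mem_Icc hne hr hdisj hrange
  have h1 : 1 / ((n : ℝ) + 1) - 1 / (n + 1 + 1) ≤ 2 * (1 / (n + 1 + 1)) ^ 2 := by
    rw [div_sub_div _ _ (by positivity) (by positivity), div_pow, mul_div_assoc',
      div_le_div_iff₀ (by positivity) (by positivity)]
    nlinarith [n.cast_nonneg (α := ℝ), sq_nonneg ((n : ℝ))]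
  have h2 : (1 / ((n : ℝ) + 1 + 1)) ^ 2 ≤ infDist y F ^ 2 := by gcongr
  linarith

/-- The positive level sets of the distance to a closed set of reals are countable. -/
lemma countable_setOf_infDist_eq {F : Set ℝ} (hF : IsClosed F) (hne : F.Nonempty) {t : ℝ}
    (ht : 0 < t) : {x : ℝ | infDist x F = t}.Countable := by
  set s := {x : ℝ | infDist x F = t} with hs
  refine ((countable_setOfPred_isolated_right_within (s := s)).union
    (countable_setOfPred_isolated_left_within (s := s))).mono fun x hx => ?_
  obtain ⟨p, hp, hxp⟩ := hF.exists_infDist_eq_dist hne x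
  have hx' : infDist x F = t := hx
  rw [hx', Real.dist_eq] at hxp
  rcases lt_or_ge p x with h | h
  · right
    refine ⟨hx, ?_⟩
    rw [abs_of_pos (by linarith)] at hxp
    refine empty_mem_iff_bot.1 ?_
    rw [mem_nhdsWithin]
    refine ⟨Ioi p, isOpen_Ioi, h, ?_⟩
    rintro y ⟨hpy, hys, hyx⟩
    have h1 : infDist y F ≤ _ := infDist_le_dist_of_mem hp
    rw [show infDist y F = t from hys, Real.dist_eq, abs_of_pos (sub_pos.2 hpy)] at h1
    simp only [mem_Iio] at hyx
    linarith
  · left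
    refine ⟨hx, ?_⟩
    rw [abs_of_nonpos (by linarith)] at hxp
    refine empty_mem_iff_bot.1 ?_
    rw [mem_nhdsWithin]
    refine ⟨Iio p, isOpen_Iio, by simp only [mem_Iio]; linarith, ?_⟩
    rintro y ⟨hpy, hys, hyx⟩
    simp only [mem_Iio] at hpy
    have h1 : infDist y F ≤ _ := infDist_le_dist_of_mem hp
    rw [show infDist y F = t from hys, Real.dist_eq, abs_of_neg (sub_neg.2 hpy)] at h1
    simp only [mem_Ioi] at hyx
    linarith

lemma volume_Fhat_diff {F : Set ℝ} (hF : IsClosed F) (hne : F.Nonempty) :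
    volume (Fhat F \ F) = 0 := by
  refine (Countable.mono (?_ : _ ⊆ ⋃ n : ℕ, {x : ℝ | infDist x F = 1 / (n + 1)})
    (countable_iUnion fun n => countable_setOf_infDist_eq hF hne (by positivity))).measure_zero _
  rintro x ⟨h | h, hx⟩
  · exact absurd h hx
  · exact h

/-- A nonempty bounded open preconnected set of reals is a ball. -/
lemma exists_eq_ball {C : Set ℝ} (ho : IsOpen C) (hc : IsConnected C)
    (hb : Bornology.IsBounded C) : ∃ c r : ℝ, 0 < r ∧ C = ball c r := by
  obtain ⟨hbb, hba⟩ := isBounded_iff_bddBelow_bddAbove.1 hb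
  have hC : C = Ioo (sInf C) (sSup C) := by
    refine Subset.antisymm (fun x hx => ?_) (hc.Ioo_csInf_csSup_subset hbb hba)
    obtain ⟨δ, hδ, hball⟩ := Metric.isOpen_iff.1 ho x hx
    rw [Real.ball_eq_Ioo] at hball
    have h1 := csInf_le hbb (hball (⟨by linarith, by linarith⟩ : x - δ / 2 ∈ Ioo (x - δ) (x + δ)))
    have h2 := le_csSup hba (hball (⟨by linarith, by linarith⟩ : x + δ / 2 ∈ Ioo (x - δ) (x + δ)))
    constructor <;> linarith
  obtain ⟨x, hx⟩ := hc.nonempty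
  rw [hC] at hx
  refine ⟨(sInf C + sSup C) / 2, (sSup C - sInf C) / 2, by linarith [hx.1, hx.2], ?_⟩
  rw [← Real.Ioo_eq_ball]
  exact hC

/-- Connected subsets of the complement of `F` staying within distance `ε` of `F` are bounded. -/
lemma isBounded_of_subset_thickening {F C : Set ℝ} (hne : F.Nonempty) {ε : ℝ}
    (hc : IsPreconnected C) (hd : Disjoint C F) (hε : C ⊆ thickening ε F) :
    Bornology.IsBounded C := by
  refine Metric.isBounded_iff.2 ⟨2 * ε, ?_⟩
  have key : ∀ u ∈ C, ∀ v ∈ C, u ≤ v → v - u ≤ 2 * ε := by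
    intro u hu v hv huv
    have hsub : Icc u v ⊆ C := hc.ordConnected.out hu hv
    have h := add_le_infDist_of_Icc_disjoint (c := (u + v) / 2) (t := (v - u) / 2) (m := 0) hne
      (hd.mono_left ((Icc_subset_Icc (by linarith) (by linarith)).trans hsub))
      infDist_nonneg infDist_nonneg
    have hm := hε (hsub (⟨by linarith, by linarith⟩ : (u + v) / 2 ∈ Icc u v))
    rw [mem_thickening_iff_infDist_lt hne] at hm
    linarith
  intro u hu v hv
  rw [Real.dist_eq, abs_le]
  rcases le_total u v with h | h
  · have := key u hu v hv h
    constructor <;> linarith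
  · have := key v hv u hu h
    constructor <;> linarith

/-- The components of the part of the complement of `Fhat F` near `F`, as a countable disjoint
family of balls. -/
lemma exists_components {F : Set ℝ} (hF : IsClosed F) (hne : F.Nonempty) (ε : ℝ) :
    ∃ (ι : Type) (_ : Countable ι) (c r : ι → ℝ), (∀ i, 0 < r i) ∧
      (Pairwise fun i j => Disjoint (ball (c i) (r i)) (ball (c j) (r j))) ∧
      (⋃ i, ball (c i) (r i)) = (Fhat F)ᶜ ∩ thickening ε F ∧
      ∀ i, ∃ x ∈ (Fhat F)ᶜ ∩ thickening ε F,
        connectedComponentIn ((Fhat F)ᶜ ∩ thickening ε F) x = ball (c i) (r i) := by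
  set W := (Fhat F)ᶜ ∩ thickening ε F with hW
  have hWo : IsOpen W := (isClosed_Fhat hF hne).isOpen_compl.inter isOpen_thickening
  have hcomp : ∀ C : connectedComponentIn W '' W, ∃ c r : ℝ, 0 < r ∧ (C : Set ℝ) = ball c r := by
    rintro ⟨_, x, hx, rfl⟩
    have hsub := connectedComponentIn_subset W x
    refine exists_eq_ball hWo.connectedComponentIn (isConnected_connectedComponentIn_iff.2 hx)
      (isBounded_of_subset_thickening hne isPreconnected_connectedComponentIn ?_
        (hsub.trans inter_subset_right))
    exact Set.disjoint_left.2 fun z hz hzF => (hsub hz).1 (Or.inl hzF)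
  choose c r hr hCr using hcomp
  have hdisj : (connectedComponentIn W '' W).PairwiseDisjoint id := by
    rintro _ ⟨x, hx, rfl⟩ _ ⟨y, hy, rfl⟩ hxy
    refine Set.disjoint_left.2 fun z hz hz' => hxy ?_
    rw [connectedComponentIn_eq hz, connectedComponentIn_eq hz']
  have hcount : (connectedComponentIn W '' W).Countable := by
    refine hdisj.countable_of_isOpen ?_ ?_
    · rintro _ ⟨x, hx, rfl⟩
      exact hWo.connectedComponentIn
    · rintro _ ⟨x, hx, rfl⟩
      exact ⟨x, mem_connectedComponentIn hx⟩
  refine ⟨connectedComponentIn W '' W, hcount.to_subtype, c, r, hr, ?_, ?_, ?_⟩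
  · intro i j hij
    rw [← hCr, ← hCr]
    exact hdisj i.2 j.2 fun h => hij (Subtype.ext h)
  · simp only [← hCr]
    ext z
    simp only [mem_iUnion, Subtype.exists, exists_prop, exists_mem_image]
    exact ⟨fun ⟨x, _, hz⟩ => connectedComponentIn_subset W x hz,
      fun hz => ⟨z, hz, mem_connectedComponentIn hz⟩⟩
  · rintro ⟨_, x, hx, rfl⟩
    exact ⟨x, hx, hCr ⟨_, x, hx, rfl⟩⟩

section Redistribution

variable {ι : Type} {F H G : Set ℝ} {c r : ι → ℝ}

open Classical in
/-- The weight spreading the length of the `i`-th ball uniformly over the part of `H` in its middle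
third, provided the ball lies in `G`. -/
noncomputable def spreadWeight (H G : Set ℝ) (c r : ι → ℝ) (i : ι) : ENNReal :=
  if ball (c i) (r i) ⊆ G then
    volume (ball (c i) (r i)) / volume (H ∩ ball (c i) (r i / 3)) else 0

/-- Lebesgue measure on `F ∩ G`, together with the length of each ball contained in `G` spread
over the part of `H` in its middle third. -/
noncomputable def spreadMeasure (F H G : Set ℝ) (c r : ι → ℝ) : Measure ℝ :=
  volume.restrict (F ∩ G) +
    Measure.sum fun i => spreadWeight H G c r i • volume.restrict (H ∩ ball (c i) (r i / 3))

lemma spreadMeasure_apply {S : Set ℝ} (hS : MeasurableSet S) :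
    spreadMeasure F H G c r S = volume (S ∩ (F ∩ G)) +
      ∑' i, spreadWeight H G c r i * volume (S ∩ (H ∩ ball (c i) (r i / 3))) := by
  simp [spreadMeasure, Measure.sum_apply _ hS, Measure.restrict_apply hS]

lemma spreadMeasure_absolutelyContinuous : spreadMeasure F H G c r ≪ volume := by
  refine Measure.AbsolutelyContinuous.add_left_iff.2 ⟨Measure.restrict_le_self.absolutelyContinuous,
    Measure.absolutelyContinuous_sum_left fun i => ?_⟩
  exact (Measure.smul_absolutelyContinuous).trans Measure.restrict_le_self.absolutelyContinuous

lemma ball_third_subset (hr : ∀ i, 0 < r i) (i : ι) :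
    H ∩ ball (c i) (r i / 3) ⊆ ball (c i) (r i) :=
  inter_subset_right.trans (ball_subset_ball (by linarith [hr i]))

lemma volume_third_ne_top (i : ι) : volume (H ∩ ball (c i) (r i / 3)) ≠ ⊤ :=
  measure_ne_top_of_subset inter_subset_right measure_ball_lt_top.ne

lemma spreadWeight_ne_top (hpos : ∀ i, 0 < volume (H ∩ ball (c i) (r i / 3))) (i : ι) :
    spreadWeight H G c r i ≠ ⊤ := by
  unfold spreadWeight
  split_ifs
  · exact ENNReal.div_ne_top measure_ball_lt_top.ne (hpos i).ne'
  · exact ENNReal.zero_ne_top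

lemma spreadWeight_mul_le (S : Set ℝ) (i : ι) :
    spreadWeight H G c r i * volume (S ∩ (H ∩ ball (c i) (r i / 3))) ≤
      volume (ball (c i) (r i)) := by
  unfold spreadWeight
  split_ifs
  · calc _ ≤ volume (ball (c i) (r i)) / volume (H ∩ ball (c i) (r i / 3)) *
          volume (H ∩ ball (c i) (r i / 3)) := mul_le_mul_right (measure_mono inter_subset_right) _
      _ ≤ _ := by rw [mul_comm]; exact ENNReal.mul_div_le
  · simp

lemma spreadWeight_mul_eq (hr : ∀ i, 0 < r i)
    (hpos : ∀ i, 0 < volume (H ∩ ball (c i) (r i / 3))) {S : Set ℝ} {i : ι}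
    (hG : ball (c i) (r i) ⊆ G) (hS : ball (c i) (r i) ⊆ S) :
    spreadWeight H G c r i * volume (S ∩ (H ∩ ball (c i) (r i / 3))) =
      volume (ball (c i) (r i)) := by
  rw [spreadWeight, if_pos hG, inter_eq_self_of_subset_right ((ball_third_subset hr i).trans hS)]
  exact ENNReal.div_mul_cancel (hpos i).ne' (volume_third_ne_top i)

/-- Inside a single ball the mass is at most a multiple of length. -/
lemma spreadMeasure_le_of_subset_ball (hr : ∀ i, 0 < r i)
    (hdisj : Pairwise fun i j => Disjoint (ball (c i) (r i)) (ball (c j) (r j)))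
    (hBF : ∀ i, Disjoint (ball (c i) (r i)) F) {S : Set ℝ} (hS : MeasurableSet S) {i : ι}
    (hSB : S ⊆ ball (c i) (r i)) :
    spreadMeasure F H G c r S ≤ spreadWeight H G c r i * volume S := by
  rw [spreadMeasure_apply hS, tsum_eq_single i]
  · have : S ∩ (F ∩ G) = ∅ := ((hBF i).mono hSB inter_subset_left).inter_eq
    rw [this, measure_empty, zero_add]
    gcongr
    exact inter_subset_left
  · intro j hj
    have : S ∩ (H ∩ ball (c j) (r j / 3)) = ∅ :=
      ((hdisj hj.symm).mono hSB (ball_third_subset hr j)).inter_eq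
    rw [this, measure_empty, mul_zero]

lemma spreadMeasure_eq_zero_of_disjoint (hFH : F ⊆ H) {S : Set ℝ} (hS : MeasurableSet S)
    (hSH : Disjoint S H) : spreadMeasure F H G c r S = 0 := by
  have h1 : S ∩ (F ∩ G) = ∅ := (hSH.mono_right (inter_subset_left.trans hFH)).inter_eq
  have h2 : ∀ i, S ∩ (H ∩ ball (c i) (r i / 3)) = ∅ :=
    fun i => (hSH.mono_right inter_subset_left).inter_eq
  simp [spreadMeasure_apply hS, h1, h2]

variable [Countable ι]

/-- If `T` contains `S` and every ball in `G` whose spread-out mass meets `S`, then the mass of `S`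
is at most the length of `G ∩ T`. -/
lemma spreadMeasure_le_volume
    (hdisj : Pairwise fun i j => Disjoint (ball (c i) (r i)) (ball (c j) (r j)))
    (hBF : ∀ i, Disjoint (ball (c i) (r i)) F) {S T : Set ℝ} (hS : MeasurableSet S) (hST : S ⊆ T)
    (hT : ∀ i, ball (c i) (r i) ⊆ G → (S ∩ (H ∩ ball (c i) (r i / 3))).Nonempty →
      ball (c i) (r i) ⊆ T) :
    spreadMeasure F H G c r S ≤ volume (G ∩ T) := by
  classical
  set B : ι → Set ℝ := fun i => if ball (c i) (r i) ⊆ G ∩ T then ball (c i) (r i) else ∅ with hB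
  have hBsub : ∀ i, B i ⊆ ball (c i) (r i) := fun i => by
    simp only [hB]; split_ifs <;> simp
  have hBGT : ∀ i, B i ⊆ G ∩ T := fun i => by
    simp only [hB]; split_ifs with h <;> simp [h]
  have hBm : ∀ i, MeasurableSet (B i) := fun i => by
    simp only [hB]; split_ifs
    · exact measurableSet_ball
    · exact MeasurableSet.empty
  have hterm : ∀ i, spreadWeight H G c r i * volume (S ∩ (H ∩ ball (c i) (r i / 3))) ≤
      volume (B i) := by
    intro i
    by_cases hG : ball (c i) (r i) ⊆ G
    · rcases (S ∩ (H ∩ ball (c i) (r i / 3))).eq_empty_or_nonempty with h | h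
      · simp [h]
      · simp only [hB]
        rw [if_pos (subset_inter hG (hT i hG h))]
        exact spreadWeight_mul_le S i
    · simp [spreadWeight, hG]
  rw [spreadMeasure_apply hS]
  calc _ ≤ volume (S ∩ (F ∩ G)) + ∑' i, volume (B i) := by
        gcongr with i; exact hterm i
    _ = volume (S ∩ (F ∩ G)) + volume (⋃ i, B i) := by
        rw [measure_iUnion (fun i j hij => (hdisj hij).mono (hBsub i) (hBsub j)) hBm]
    _ = volume (S ∩ (F ∩ G) ∪ ⋃ i, B i) := by
        refine (measure_union ?_ (MeasurableSet.iUnion hBm)).symm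
        rw [disjoint_iUnion_right]
        exact fun i => ((hBF i).mono (hBsub i) (fun _ h => h.2.1)).symm
    _ ≤ volume (G ∩ T) := measure_mono (union_subset
        (fun x hx => ⟨hx.2.2, hST hx.1⟩) (iUnion_subset hBGT))

/-- An interval containing a point outside all balls in `G` has mass at most the length of `G` in
a fivefold enlargement of it. -/
lemma spreadMeasure_Ioo_le
    (hdisj : Pairwise fun i j => Disjoint (ball (c i) (r i)) (ball (c j) (r j)))
    (hBF : ∀ i, Disjoint (ball (c i) (r i)) F) {a b e : ℝ} (he : e ∈ Ioo a b)
    (heB : ∀ i, ball (c i) (r i) ⊆ G → e ∉ ball (c i) (r i)) :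
    spreadMeasure F H G c r (Ioo a b) ≤
      volume (G ∩ Ioo (a - 2 * (b - a)) (b + 2 * (b - a))) := by
  have hab : a < b := he.1.trans he.2
  refine spreadMeasure_le_volume hdisj hBF measurableSet_Ioo
    (Ioo_subset_Ioo (by linarith) (by linarith)) fun i hG => ?_
  rintro ⟨y, hy, -, hyB⟩
  have heB := heB i hG
  rw [Real.ball_eq_Ioo] at heB hyB ⊢
  obtain ⟨he1, he2⟩ := he
  obtain ⟨hy1, hy2⟩ := hy
  obtain ⟨hy3, hy4⟩ := hyB
  have : e ≤ c i - r i ∨ c i + r i ≤ e := by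
    by_contra! h
    exact heB ⟨h.1, h.2⟩
  refine Ioo_subset_Ioo ?_ ?_ <;> rcases this with h | h <;> linarith

/-- Near a point `x` of `F` interior to `G`, the mass of the interval between `x` and `y` agrees
with its length up to the length of the ball containing `y`. -/
lemma spreadMeasure_sub_volume_le (hF : IsClosed F) (hr : ∀ i, 0 < r i)
    (hdisj : Pairwise fun i j => Disjoint (ball (c i) (r i)) (ball (c j) (r j)))
    (hBF : ∀ i, Disjoint (ball (c i) (r i)) F)
    (hpos : ∀ i, 0 < volume (H ∩ ball (c i) (r i / 3))) {J : Set ℝ} {y : ℝ} {K : ENNReal}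
    (hJ : MeasurableSet J) (hJG : J ⊆ G) (hJnull : volume (J \ (F ∪ ⋃ i, ball (c i) (r i))) = 0)
    (hJB : ∀ i, Disjoint J (ball (c i) (r i)) ∨ ball (c i) (r i) ⊆ J ∨ y ∈ ball (c i) (r i))
    (hK : ∀ i, y ∈ ball (c i) (r i) → volume (ball (c i) (r i)) ≤ K) :
    spreadMeasure F H G c r J ≤ volume J + K ∧ volume J ≤ spreadMeasure F H G c r J + K := by
  have hvol : volume J = volume (J ∩ (F ∩ G)) + ∑' i, volume (J ∩ ball (c i) (r i)) := by
    rw [← measure_iUnion (fun i j hij => (hdisj hij).mono inter_subset_right inter_subset_right)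
      (fun i => hJ.inter measurableSet_ball), ← inter_iUnion, ← measure_union]
    · rw [inter_comm F G, ← inter_assoc, inter_eq_self_of_subset_left hJG,
        ← inter_union_distrib_left]
      refine le_antisymm ?_ (measure_mono inter_subset_left)
      rw [← measure_inter_add_sdiff J (hF.measurableSet.union
        (MeasurableSet.iUnion fun i => measurableSet_ball (x := c i) (ε := r i))), hJnull, add_zero]
    · rw [inter_iUnion, disjoint_iUnion_right]
      exact fun i => ((hBF i).mono inter_subset_right (fun _ h => h.2.1)).symm
    · exact hJ.inter (MeasurableSet.iUnion fun i => measurableSet_ball)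
  have hsumK : ∑' i, K * Measure.dirac y (ball (c i) (r i)) ≤ K := by
    rw [ENNReal.tsum_mul_left, ← measure_iUnion hdisj fun i => measurableSet_ball]
    exact mul_le_of_le_one_right' prob_le_one
  have hterm : ∀ i, spreadWeight H G c r i * volume (J ∩ (H ∩ ball (c i) (r i / 3))) ≤
        volume (J ∩ ball (c i) (r i)) + K * Measure.dirac y (ball (c i) (r i)) ∧
      volume (J ∩ ball (c i) (r i)) ≤
        spreadWeight H G c r i * volume (J ∩ (H ∩ ball (c i) (r i / 3))) +
          K * Measure.dirac y (ball (c i) (r i)) := by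
    intro i
    rcases hJB i with h | h | h
    · have h1 : J ∩ ball (c i) (r i) = ∅ := h.inter_eq
      have h2 : J ∩ (H ∩ ball (c i) (r i / 3)) = ∅ :=
        (h.mono_right (ball_third_subset hr i)).inter_eq
      simp [h1, h2]
    · rw [spreadWeight_mul_eq hr hpos (h.trans hJG) h, inter_eq_self_of_subset_right h]
      exact ⟨le_self_add, le_self_add⟩
    · rw [Measure.dirac_apply_of_mem h, mul_one]
      exact ⟨(spreadWeight_mul_le J i).trans ((hK i h).trans le_add_self),
        (measure_mono inter_subset_right).trans ((hK i h).trans le_add_self)⟩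
  rw [spreadMeasure_apply hJ, hvol, add_assoc, add_assoc]
  refine ⟨add_le_add_right ?_ _, add_le_add_right ?_ _⟩
  · refine (ENNReal.tsum_le_tsum fun i => (hterm i).1).trans ?_
    rw [ENNReal.tsum_add]
    gcongr
  · refine (ENNReal.tsum_le_tsum fun i => (hterm i).2).trans ?_
    rw [ENNReal.tsum_add]
    gcongr

end Redistribution

/-- Increments of the distribution function between points of an interval. -/
lemma abs_measureReal_Iic_sub_le (ν : Measure ℝ) [IsFiniteMeasure ν] {I : Set ℝ}
    (hI : I.OrdConnected) {s t : ℝ} (hs : s ∈ I) (ht : t ∈ I) :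
    |ν.real (Iic s) - ν.real (Iic t)| ≤ ν.real I := by
  wlog h : s ≤ t generalizing s t
  · rw [abs_sub_comm]
    exact this ht hs (not_le.1 h).le
  rw [abs_sub_comm, measureReal_Iic_sub ν h, abs_of_nonneg measureReal_nonneg]
  exact measureReal_mono (Ioc_subset_Icc_self.trans (hI.out hs ht))

/-- If the mass of small balls about `x` is at most a multiple of the radius, then the upper
pointwise Lipschitz constant of the distribution function is finite at `x`. -/
lemma lipSup_measureReal_Iic_lt_top (ν : Measure ℝ) [IsFiniteMeasure ν] {x K ρ₀ : ℝ} (hρ₀ : 0 < ρ₀)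
    (h : ∀ ρ, 0 < ρ → ρ < ρ₀ → ν.real (ball x ρ) ≤ K * ρ) :
    lipSup (fun x => ν.real (Iic x)) x < ⊤ := by
  refine lt_of_le_of_lt (b := ENNReal.ofReal K) ?_ ENNReal.ofReal_lt_top
  refine limsup_le_of_le (by isBoundedDefault) ?_
  filter_upwards [Ioo_mem_nhdsGT hρ₀] with ρ hρ
  refine iSup₂_le fun y hy => ENNReal.ofReal_le_ofReal ?_
  rw [div_le_iff₀ hρ.1]
  exact (abs_measureReal_Iic_sub_le ν (convex_ball x ρ).ordConnected hy
    (mem_ball_self hρ.1)).trans (h ρ hρ.1 hρ.2)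

theorem exists_function_g (E F A M : Set ℝ) (hE : IsClosed E) (hF : IsClosed F)
    (hA : MeasurableSet A) (hM : MeasurableSet M)
    (hAnull : MeasureTheory.volume A = 0) (hEPM : EPM M)
    (ε : ℝ) (hε : 0 < ε) (H : Set ℝ) (hH : IsClosed H)
    (hFH : F ⊆ H) (hHsub : H ⊆ (F ∪ M) ∩ Metric.thickening ε F)
    (hHmid : ∀ x ∈ (Fhat F)ᶜ ∩ Metric.thickening ε F, ∀ c r : ℝ, 0 < r →
      connectedComponentIn ((Fhat F)ᶜ ∩ Metric.thickening ε F) x = Metric.ball c r →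
      0 < MeasureTheory.volume (H ∩ Metric.ball c (r / 3))) :
    ∃ g : ℝ → ℝ, Monotone g ∧ AbsCont g ∧ (∀ x, g x ∈ Set.Icc 0 ε) ∧
      (∀ x ∉ H, ∃ δ > (0:ℝ), ∀ y ∈ Metric.ball x δ, g y = g x) ∧
      (∀ x : ℝ, lipSup g x < ⊤) ∧
      (∀ x ∈ A ∩ F ∩ Eᶜ, HasDerivAt g 1 x) ∧
      (∀ a b : ℝ, a < b → (Set.Ioo a b ∩ E).Nonempty →
        ∀ s ∈ Set.Ioo a b, ∀ t ∈ Set.Ioo a b, |g s - g t| ≤ ε * (b - a)) ∧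
      MeasureTheory.Integrable (deriv g) ∧ (∫ x, |deriv g x|) < ε := by
  rcases F.eq_empty_or_nonempty with rfl | hne
  · refine ⟨fun _ => 0, monotone_const, ?_, fun x => ⟨le_rfl, hε.le⟩,
      fun x _ => ⟨1, one_pos, fun _ _ => rfl⟩, ?_, fun x hx => hx.1.2.elim, ?_, ?_, ?_⟩
    · intro η hη
      exact ⟨1, one_pos, fun n a b _ _ _ => by simpa using hη⟩
    · intro x
      simp [lipSup]
    · intro a b hab _ s _ t _
      simpa using mul_nonneg hε.le (sub_nonneg.2 hab.le)
    · simp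
    · simpa using hε
  obtain ⟨G, hGo, hAG, hGE, hGv, hGI⟩ :=
    exists_isOpen_small_near hAnull hE (η := ε / 5) (by positivity)
  obtain ⟨ι, hι, c, r, hr, hdisj, hW, hcomp⟩ := exists_components hF hne ε
  have hsub : ∀ i, ball (c i) (r i) ⊆ (Fhat F)ᶜ := fun i =>
    (subset_iUnion (fun i => ball (c i) (r i)) i).trans (hW.trans_subset inter_subset_left)
  have hBF : ∀ i, Disjoint (ball (c i) (r i)) F := fun i =>
    Set.disjoint_left.2 fun z hz hzF => hsub i hz (Or.inl hzF)
  have hpos : ∀ i, 0 < volume (H ∩ ball (c i) (r i / 3)) := by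
    intro i
    obtain ⟨x, hx, hxi⟩ := hcomp i
    exact hHmid x hx _ _ (hr i) hxi
  set ν := spreadMeasure F H G c r with hνdef
  have hac : ν ≪ volume := spreadMeasure_absolutelyContinuous
  have huniv : ν univ ≤ ENNReal.ofReal (ε / 5) := by
    refine (spreadMeasure_le_volume hdisj hBF MeasurableSet.univ (subset_univ _)
      fun i _ _ => subset_univ _).trans ?_
    rwa [inter_univ]
  have hfin : IsFiniteMeasure ν := ⟨huniv.trans_lt ENNReal.ofReal_lt_top⟩
  have huniv' : ν.real univ ≤ ε / 5 := ENNReal.toReal_le_of_le_ofReal (by positivity) huniv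
  refine ⟨fun x => ν.real (Iic x), monotone_measureReal_Iic ν, absCont_measureReal_Iic ν hac,
    fun x => ⟨measureReal_nonneg, (measureReal_mono (subset_univ _)).trans
      (huniv'.trans (by linarith))⟩, ?_, ?_, ?_, ?_,
    (integrable_deriv_measureReal_Iic ν hac).1,
    ((integrable_deriv_measureReal_Iic ν hac).2.trans huniv').trans_lt (by linarith)⟩
  · intro x hx
    obtain ⟨δ, hδ, hball⟩ := Metric.isOpen_iff.1 hH.isOpen_compl x hx
    refine ⟨δ, hδ, fun y hy => ?_⟩
    have h0 : ν.real (ball x δ) = 0 := by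
      rw [measureReal_def, spreadMeasure_eq_zero_of_disjoint hFH measurableSet_ball
        (Set.disjoint_left.2 fun z hz => hball hz), ENNReal.toReal_zero]
    have := abs_measureReal_Iic_sub_le ν (convex_ball x δ).ordConnected hy (mem_ball_self hδ)
    rw [h0] at this
    exact sub_eq_zero.1 (abs_nonpos_iff.1 this)
  · intro x
    by_cases hx : ∃ i, x ∈ ball (c i) (r i)
    · obtain ⟨i, hi⟩ := hx
      obtain ⟨ρ₀, hρ₀, hball⟩ := Metric.isOpen_iff.1 isOpen_ball x hi
      refine lipSup_measureReal_Iic_lt_top ν (K := (spreadWeight H G c r i).toReal * 2) hρ₀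
        fun ρ hρ hρρ₀ => ?_
      have := spreadMeasure_le_of_subset_ball (H := H) (G := G) hr hdisj hBF
        (measurableSet_ball (x := x) (ε := ρ)) ((ball_subset_ball hρρ₀.le).trans hball)
      have h2 := ENNReal.toReal_mono (ENNReal.mul_ne_top (spreadWeight_ne_top hpos i)
        measure_ball_lt_top.ne) this
      rw [ENNReal.toReal_mul, Real.volume_ball, ENNReal.toReal_ofReal (by positivity)] at h2
      rwa [mul_assoc]
    · refine lipSup_measureReal_Iic_lt_top ν (K := 10) one_pos fun ρ hρ _ => ?_
      have := spreadMeasure_Ioo_le (H := H) (G := G) hdisj hBF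
        (⟨by linarith, by linarith⟩ : x ∈ Ioo (x - ρ) (x + ρ)) fun i _ hi => hx ⟨i, hi⟩
      rw [← Real.ball_eq_Ioo] at this
      refine ENNReal.toReal_le_of_le_ofReal (by positivity) ?_
      refine this.trans ((measure_mono inter_subset_right).trans ?_)
      rw [Real.volume_Ioo]
      exact ENNReal.ofReal_le_ofReal (by linarith)
  · rintro x ⟨⟨hxA, hxF⟩, hxE⟩
    obtain ⟨ρ, hρ, hball⟩ := Metric.isOpen_iff.1 (hGo.inter (isOpen_thickening (δ := ε) (E := F))) x
      ⟨hAG ⟨hxA, hxE⟩, self_subset_thickening hε F hxF⟩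
    have hbound : ∀ y, |y - x| < min ρ 1 →
        |ν.real (Iic y) - ν.real (Iic x) - (y - x)| ≤ 4 * |y - x| ^ 2 := by
      intro y hy
      have hyρ := hy.trans_le (min_le_left _ _)
      have hy1 := hy.trans_le (min_le_right _ _)
      have hinf : infDist y F ≤ |y - x| := infDist_le_dist_of_mem hxF
      have hJ : Ioc (min x y) (max x y) ⊆ G ∩ thickening ε F := by
        refine Subset.trans (fun z hz => ?_) hball
        rw [mem_ball, Real.dist_eq]
        refine lt_of_le_of_lt ?_ hyρ
        exact abs_sub_left_of_mem_uIcc (Ioc_subset_Icc_self hz)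
      have hmain := spreadMeasure_sub_volume_le (G := G) (J := Ioc (min x y) (max x y)) (y := y)
        (K := ENNReal.ofReal (4 * |y - x| ^ 2)) hF hr hdisj hBF hpos measurableSet_Ioc
        (hJ.trans inter_subset_left) ?_ ?_ ?_
      · rw [Real.volume_Ioc, max_sub_min_eq_abs, ← hνdef, ← ofReal_measureReal (μ := ν),
          ← ENNReal.ofReal_add (abs_nonneg _) (by positivity),
          ← ENNReal.ofReal_add measureReal_nonneg (by positivity),
          ENNReal.ofReal_le_ofReal_iff (by positivity),
          ENNReal.ofReal_le_ofReal_iff (add_nonneg measureReal_nonneg (by positivity)),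
          ← measureReal_Iic_sub ν min_le_max] at hmain
        rcases le_total x y with h | h
        · rw [min_eq_left h, max_eq_right h, abs_of_nonneg (sub_nonneg.2 h)] at hmain
          rw [abs_of_nonneg (sub_nonneg.2 h), abs_le]
          constructor <;> linarith [hmain.1, hmain.2]
        · rw [min_eq_right h, max_eq_left h, abs_of_nonpos (sub_nonpos.2 h)] at hmain
          rw [abs_of_nonpos (sub_nonpos.2 h), abs_le]
          constructor <;> linarith [hmain.1, hmain.2]
      · refine measure_mono_null (fun z hz => ?_) (volume_Fhat_diff hF hne)
        rw [hW] at hz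
        refine ⟨?_, fun h => hz.2 (Or.inl h)⟩
        by_contra h
        exact hz.2 (Or.inr ⟨h, (hJ hz.1).2⟩)
      · intro i
        have hxB : x ∉ ball (c i) (r i) := fun h => Set.disjoint_left.1 (hBF i) h hxF
        have hord := (convex_ball (c i) (r i)).ordConnected
        by_contra! hcon
        obtain ⟨hc1, hc2, hc3⟩ := hcon
        obtain ⟨z, hz, hzB⟩ := Set.not_disjoint_iff.1 hc1
        obtain ⟨w, hwB, hw⟩ := Set.not_subset.1 hc2
        have hIoc : w ≤ min x y ∨ max x y < w := by
          by_contra! h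
          exact hw h
        rcases hIoc with h | h
        · rcases min_choice x y with hm | hm
          · exact hxB (hord.out hwB hzB ⟨by rw [← hm]; exact h, by rw [← hm]; exact hz.1.le⟩)
          · exact hc3 (hord.out hwB hzB ⟨by rw [← hm]; exact h, by rw [← hm]; exact hz.1.le⟩)
        · rcases max_choice x y with hm | hm
          · exact hxB (hord.out hzB hwB ⟨by rw [← hm]; exact hz.2, by rw [← hm]; exact h.le⟩)
          · exact hc3 (hord.out hzB hwB ⟨by rw [← hm]; exact hz.2, by rw [← hm]; exact h.le⟩)
      · intro i hi
        rw [Real.volume_ball]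
        refine ENNReal.ofReal_le_ofReal
          ((two_mul_radius_le_sq hF hne (hr i) (hsub i) hi (hinf.trans_lt hy1)).trans ?_)
        gcongr
        exact infDist_nonneg
    rw [hasDerivAt_iff_isLittleO]
    refine (Asymptotics.IsBigO.of_bound 4 ?_ :
      (fun y => ν.real (Iic y) - ν.real (Iic x) - (y - x) • (1 : ℝ)) =O[𝓝 x]
        fun y => (y - x) ^ 2).trans_isLittleO ?_
    · filter_upwards [ball_mem_nhds x (lt_min hρ one_pos)] with y hy
      rw [mem_ball, Real.dist_eq] at hy
      simpa using hbound y hy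
    · refine Asymptotics.IsLittleO.of_norm_left ?_
      simpa only [norm_pow] using Asymptotics.isLittleO_pow_sub_sub x one_lt_two
  · rintro a b hab ⟨e, heI, heE⟩ s hs t ht
    refine (abs_measureReal_Iic_sub_le ν ordConnected_Ioo hs ht).trans ?_
    have h1 := spreadMeasure_Ioo_le (H := H) (G := G) hdisj hBF heI
      fun i hi he => Set.disjoint_left.1 hGE (hi he) heE
    have h2 := hGI (a - 2 * (b - a)) (b + 2 * (b - a))
      ⟨e, ⟨by linarith [heI.1], by linarith [heI.2]⟩, heE⟩
    refine (ENNReal.toReal_le_of_le_ofReal ?_ (h1.trans h2)).trans ?_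
    · exact mul_nonneg (by positivity) (by linarith)
    · exact le_of_eq (by ring)
end

section
/- Suppose A ⊆ ℝ is an F_{σδ} set of Lebesgue measure zero. Then there exists a nondecreasing absolutely continuous function g: ℝ → ℝ such that g'(x) = ∞ (hence lip g(x) = ∞) for every x ∈ A, and lip g(x) < ∞ for every x ∉ A. -/
open Filter MeasureTheory Set Metric Topology

/-- The dyadic interval `[i / 2 ^ k, (i + 1) / 2 ^ k)`. -/
def dyadicCell (k : ℕ) (i : ℤ) : Set ℝ := {y | ⌊(2 : ℝ) ^ k * y⌋ = i}

theorem measurableSet_dyadicCell (k : ℕ) (i : ℤ) : MeasurableSet (dyadicCell k i) :=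
  (Int.measurable_floor.comp (measurable_const_mul ((2 : ℝ) ^ k))) (measurableSet_singleton i)

theorem abs_sub_lt_of_mem_dyadicCell {k : ℕ} {i : ℤ} {y z : ℝ}
    (hy : y ∈ dyadicCell k i) (hz : z ∈ dyadicCell k i) : |y - z| < (1 / 2) ^ k := by
  have h : |(2 : ℝ) ^ k * y - 2 ^ k * z| < 1 :=
    Int.abs_sub_lt_one_of_floor_eq_floor (hy.trans hz.symm)
  rw [← mul_sub, abs_mul, abs_of_pos (by positivity : (0 : ℝ) < 2 ^ k)] at h
  rw [one_div, inv_pow, ← one_div, lt_div_iff₀ (by positivity)]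
  linarith

theorem volume_dyadicCell_ne_zero (k : ℕ) (i : ℤ) : volume (dyadicCell k i) ≠ 0 := by
  have hp : (0 : ℝ) < 2 ^ k := by positivity
  have hsub : Ioo ((i : ℝ) / 2 ^ k) ((i + 1) / 2 ^ k) ⊆ dyadicCell k i := by
    intro y hy
    rw [mem_Ioo, div_lt_iff₀ hp, lt_div_iff₀ hp] at hy
    rw [dyadicCell, mem_ofPred_eq, Int.floor_eq_iff]
    constructor <;> linarith [hy.1, hy.2]
  refine (lt_of_lt_of_le ?_ (measure_mono hsub)).ne'
  rw [Real.volume_Ioo, ENNReal.ofReal_pos, ← sub_div]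
  apply div_pos _ hp
  linarith

theorem finite_setOf_dyadicCell_inter_ball_nonempty (k : ℕ) (x r : ℝ) :
    {i | (dyadicCell k i ∩ ball x r).Nonempty}.Finite := by
  refine (finite_Icc ⌊(2 : ℝ) ^ k * (x - r)⌋ ⌊(2 : ℝ) ^ k * (x + r)⌋).subset ?_
  rintro i ⟨y, rfl, hy⟩
  rw [Real.ball_eq_Ioo] at hy
  exact ⟨Int.floor_mono (by gcongr; exact hy.1.le), Int.floor_mono (by gcongr; exact hy.2.le)⟩

theorem locallyFinite_dyadicCell (k : ℕ) : LocallyFinite (dyadicCell k) := fun x =>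
  ⟨ball x 1, ball_mem_nhds x one_pos, finite_setOf_dyadicCell_inter_ball_nonempty k x 1⟩

/-- The points of a dyadic interval whose distance to `F` is between two and four times its
length. -/
def whitneyCell (F : Set ℝ) (k : ℕ) (i : ℤ) : Set ℝ :=
  dyadicCell k i ∩ (thickening (4 * (1 / 2) ^ k) F \ thickening (2 * (1 / 2) ^ k) F)

theorem measurableSet_whitneyCell (F : Set ℝ) (k : ℕ) (i : ℤ) :
    MeasurableSet (whitneyCell F k i) :=
  (measurableSet_dyadicCell k i).inter
    (isOpen_thickening.measurableSet.diff isOpen_thickening.measurableSet)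

theorem two_mul_le_dist_of_mem_whitneyCell {F : Set ℝ} {k : ℕ} {i : ℤ} {y x : ℝ}
    (hy : y ∈ whitneyCell F k i) (hx : x ∈ F) : 2 * (1 / 2) ^ k ≤ |y - x| := by
  by_contra! h
  exact hy.2.2 (mem_thickening_iff.2 ⟨x, hx, h⟩)

theorem two_mul_half_pow_le {k l : ℕ} (h : k < l) :
    4 * (1 / 2 : ℝ) ^ l ≤ 2 * (1 / 2) ^ k := by
  have : (1 / 2 : ℝ) ^ l ≤ (1 / 2) ^ (k + 1) :=
    pow_le_pow_of_le_one (by norm_num) (by norm_num) h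
  rw [pow_succ] at this
  linarith

theorem pairwise_disjoint_whitneyCell (F : Set ℝ) :
    Pairwise (Function.onFun Disjoint fun p : ℕ × ℤ => whitneyCell F p.1 p.2) := by
  have key : ∀ k l i j y, y ∈ whitneyCell F k i → y ∈ whitneyCell F l j → ¬ k < l :=
    fun k l i j y hy hy' h => hy.2.2 (thickening_mono (two_mul_half_pow_le h) F hy'.2.1)
  rintro ⟨k, i⟩ ⟨l, j⟩ hne
  rw [Function.onFun, disjoint_left]
  intro y hy hy'
  obtain rfl : k = l := le_antisymm (not_lt.1 (key _ _ _ _ y hy' hy))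
    (not_lt.1 (key _ _ _ _ y hy hy'))
  exact hne (congrArg (Prod.mk k) (hy.1.symm.trans hy'.1))

theorem disjoint_whitneyCell {F : Set ℝ} (k : ℕ) (i : ℤ) : Disjoint F (whitneyCell F k i) := by
  rw [disjoint_right]
  intro y hy hyF
  exact hy.2.2 (self_subset_thickening (by positivity) F hyF)

/-- The Whitney cells cover the part of a neighbourhood of a closed set `F` outside `F`. -/
theorem exists_mem_whitneyCell {F : Set ℝ} (hF : IsClosed F) {n : ℕ} {y : ℝ}
    (hy : y ∈ thickening (4 * (1 / 2) ^ n) F) (hyF : y ∉ F) :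
    ∃ k i, y ∈ whitneyCell F k i := by
  classical
  have hex : ∃ k, y ∉ thickening (4 * (1 / 2 : ℝ) ^ (n + k)) F := by
    by_contra! h
    apply hyF
    rw [← hF.closure_eq, Metric.mem_closure_iff]
    intro ε hε
    obtain ⟨k, hk⟩ := exists_pow_lt_of_lt_one (by positivity : 0 < ε / 4)
      (by norm_num : (1 / 2 : ℝ) < 1)
    obtain ⟨z, hz, hyz⟩ := mem_thickening_iff.1 (h k)
    refine ⟨z, hz, hyz.trans_le ?_⟩
    have : (1 / 2 : ℝ) ^ (n + k) ≤ (1 / 2) ^ k :=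
      pow_le_pow_of_le_one (by norm_num) (by norm_num) (by omega)
    linarith
  obtain ⟨m, hm⟩ : ∃ m, Nat.find hex = m + 1 := by
    refine Nat.exists_eq_succ_of_ne_zero fun h0 => ?_
    have := Nat.find_spec hex
    rw [h0] at this
    exact this hy
  refine ⟨n + m, _, rfl, ?_, ?_⟩
  · exact not_not.1 (Nat.find_min hex (m := m) (by omega))
  · have := Nat.find_spec hex
    rw [hm, ← add_assoc, pow_succ] at this
    convert this using 3
    ring

theorem le_of_mem_whitneyCell_of_mem_thickening {F : Set ℝ} {n k : ℕ} {i : ℤ} {y : ℝ}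
    (hy : y ∈ whitneyCell F k i) (hy' : y ∈ thickening (4 * (1 / 2) ^ n) F) : n ≤ k := by
  by_contra! h
  exact hy.2.2 (thickening_mono (two_mul_half_pow_le h) F hy')

/-- Lebesgue measure on `U`, with the mass of each Whitney cell of `F` spread over the set
`Z k i`. -/
noncomputable def transportedVolume (F U : Set ℝ) (Z : ℕ → ℤ → Set ℝ) : Measure ℝ :=
  volume.restrict (F ∩ U) + Measure.sum fun p : ℕ × ℤ =>
    volume (whitneyCell F p.1 p.2 ∩ U) • ProbabilityTheory.cond volume (Z p.1 p.2)

theorem transportedVolume_apply (F U : Set ℝ) (Z : ℕ → ℤ → Set ℝ) {S : Set ℝ}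
    (hS : MeasurableSet S) :
    transportedVolume F U Z S = volume (S ∩ (F ∩ U)) + ∑' p : ℕ × ℤ,
      volume (whitneyCell F p.1 p.2 ∩ U) * ProbabilityTheory.cond volume (Z p.1 p.2) S := by
  simp only [transportedVolume, Measure.add_apply, Measure.restrict_apply hS,
    Measure.sum_apply _ hS, Measure.smul_apply, smul_eq_mul]

theorem transportedVolume_absolutelyContinuous (F U : Set ℝ) (Z : ℕ → ℤ → Set ℝ) :
    transportedVolume F U Z ≪ volume := by
  refine Measure.AbsolutelyContinuous.add_left Measure.absolutelyContinuous_restrict ?_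
  exact Measure.absolutelyContinuous_sum_left fun p =>
    Measure.AbsolutelyContinuous.smul_left ProbabilityTheory.cond_absolutelyContinuous _

theorem transportedVolume_le {F U : Set ℝ} {Z : ℕ → ℤ → Set ℝ} (hU : IsOpen U)
    {S S' : Set ℝ} (hS : MeasurableSet S) (hS' : MeasurableSet S') (hFS : F ∩ S ⊆ S')
    (hZ : ∀ k i, (Z k i ∩ S).Nonempty → whitneyCell F k i ∩ U ⊆ S') :
    transportedVolume F U Z S ≤ volume (U ∩ S') := by
  have hterm : ∀ p : ℕ × ℤ, volume (whitneyCell F p.1 p.2 ∩ U) *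
      ProbabilityTheory.cond volume (Z p.1 p.2) S
        ≤ volume (whitneyCell F p.1 p.2 ∩ (U ∩ S')) := by
    rintro ⟨k, i⟩
    rw [ProbabilityTheory.cond_apply' hS]
    rcases (Z k i ∩ S).eq_empty_or_nonempty with h | h
    · simp [h]
    · refine (mul_le_of_le_one_right' ?_).trans
        (measure_mono fun y hy => ⟨hy.1, hy.2, hZ k i h hy⟩)
      exact (mul_le_mul_right (measure_mono inter_subset_left) _).trans
        (ENNReal.inv_mul_le_one _)
  have hm : ∀ p : ℕ × ℤ, MeasurableSet (whitneyCell F p.1 p.2 ∩ (U ∩ S')) := fun p =>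
    (measurableSet_whitneyCell F p.1 p.2).inter (hU.measurableSet.inter hS')
  rw [transportedVolume_apply F U Z hS]
  calc _ ≤ volume (S ∩ (F ∩ U)) + ∑' p : ℕ × ℤ, volume (whitneyCell F p.1 p.2 ∩ (U ∩ S')) :=
        add_le_add_right (ENNReal.tsum_le_tsum hterm) _
    _ = volume (S ∩ (F ∩ U)) + volume (⋃ p : ℕ × ℤ, whitneyCell F p.1 p.2 ∩ (U ∩ S')) := by
        rw [measure_iUnion _ hm]
        exact fun p q hpq => (pairwise_disjoint_whitneyCell F hpq).mono inter_subset_left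
          inter_subset_left
    _ = volume (S ∩ (F ∩ U) ∪ ⋃ p : ℕ × ℤ, whitneyCell F p.1 p.2 ∩ (U ∩ S')) := by
        rw [measure_union _ (MeasurableSet.iUnion hm)]
        exact disjoint_iUnion_right.2 fun p => (disjoint_whitneyCell p.1 p.2).mono
          (fun y hy => hy.2.1) inter_subset_left
    _ ≤ volume (U ∩ S') := by
        refine measure_mono (union_subset (fun y hy => ⟨hy.2.2, hFS ⟨hy.2.1, hy.1⟩⟩) ?_)
        exact iUnion_subset fun p => inter_subset_right

theorem le_transportedVolume {F U : Set ℝ} {Z : ℕ → ℤ → Set ℝ} (hF : IsClosed F) {n : ℕ}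
    (hUF : U ⊆ thickening (4 * (1 / 2) ^ n) F) (hZc : ∀ k i, IsCompact (Z k i))
    (hZ0 : ∀ k i, (whitneyCell F k i ∩ U).Nonempty → volume (Z k i) ≠ 0)
    {S S' : Set ℝ} (hS : MeasurableSet S) (hFS : F ∩ S' ⊆ S)
    (hZ : ∀ k i, (whitneyCell F k i ∩ (U ∩ S')).Nonempty → Z k i ⊆ S) :
    volume (U ∩ S') ≤ transportedVolume F U Z S := by
  have hterm : ∀ p : ℕ × ℤ, volume (whitneyCell F p.1 p.2 ∩ (U ∩ S')) ≤
      volume (whitneyCell F p.1 p.2 ∩ U) * ProbabilityTheory.cond volume (Z p.1 p.2) S := by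
    rintro ⟨k, i⟩
    rcases (whitneyCell F k i ∩ (U ∩ S')).eq_empty_or_nonempty with h | h
    · simp [h]
    · rw [ProbabilityTheory.cond_apply' hS, inter_eq_left.2 (hZ k i h),
        ENNReal.inv_mul_cancel (hZ0 k i (h.mono fun y hy => ⟨hy.1, hy.2.1⟩))
          (hZc k i).measure_lt_top.ne, mul_one]
      exact measure_mono fun y hy => ⟨hy.1, hy.2.1⟩
  rw [transportedVolume_apply F U Z hS]
  calc volume (U ∩ S')
      ≤ volume (S ∩ (F ∩ U) ∪ ⋃ p : ℕ × ℤ, whitneyCell F p.1 p.2 ∩ (U ∩ S')) := by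
        refine measure_mono fun y hy => ?_
        by_cases hyF : y ∈ F
        · exact Or.inl ⟨hFS ⟨hyF, hy.2⟩, hyF, hy.1⟩
        · obtain ⟨k, i, hki⟩ := exists_mem_whitneyCell hF (hUF hy.1) hyF
          exact Or.inr (mem_iUnion.2 ⟨(k, i), hki, hy⟩)
    _ ≤ volume (S ∩ (F ∩ U)) + ∑' p : ℕ × ℤ, volume (whitneyCell F p.1 p.2 ∩ (U ∩ S')) :=
        (measure_union_le _ _).trans (add_le_add_right (measure_iUnion_le _) _)
    _ ≤ _ := add_le_add_right (ENNReal.tsum_le_tsum hterm) _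

/-- Around every point the transported volume has bounded ratio to the radius at small scales. -/
theorem exists_transportedVolume_ball_le {F U : Set ℝ} {Z : ℕ → ℤ → Set ℝ} (hF : IsClosed F)
    (hU : IsOpen U) (hZs : ∀ k i, Z k i ⊆ dyadicCell k i)
    (hZ0 : ∀ k i, (whitneyCell F k i ∩ U).Nonempty → volume (Z k i) ≠ 0) (hUt : volume U ≠ ⊤)
    (x : ℝ) :
    ∃ M : ENNReal, M ≠ ⊤ ∧ ∃ δ > 0, ∀ r, 0 < r → r < δ →
      transportedVolume F U Z (ball x r) ≤ M * ENNReal.ofReal r := by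
  by_cases hx : x ∈ F
  · refine ⟨4, by norm_num, 1, one_pos, fun r hr _ => ?_⟩
    calc transportedVolume F U Z (ball x r) ≤ volume (U ∩ ball x (2 * r)) := by
          refine transportedVolume_le hU measurableSet_ball measurableSet_ball
            (fun y hy => ball_subset_ball (by linarith) hy.2) ?_
          rintro k i ⟨z, hz, hzx⟩ y ⟨hy, -⟩
          have h1 := two_mul_le_dist_of_mem_whitneyCell hy hx
          have h2 := abs_sub_lt_of_mem_dyadicCell hy.1 (hZs k i hz)
          rw [mem_ball, Real.dist_eq] at hzx ⊢
          have h3 := abs_sub_le y z x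
          linarith
      _ ≤ volume (ball x (2 * r)) := measure_mono inter_subset_right
      _ = 4 * ENNReal.ofReal r := by
          rw [Real.volume_ball, ← mul_assoc, ENNReal.ofReal_mul (by norm_num)]
          norm_num
  · obtain ⟨d, hd, hdF⟩ : ∃ d > 0, ∀ z ∈ F, d ≤ |x - z| := by
      obtain ⟨d, hd, h⟩ := Metric.isOpen_iff.1 hF.isOpen_compl x hx
      refine ⟨d, hd, fun z hz => ?_⟩
      by_contra! hlt
      exact h (by rwa [mem_ball, dist_comm]) hz
    obtain ⟨K, hK⟩ := exists_pow_lt_of_lt_one (by positivity : 0 < d / 10)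
      (by norm_num : (1 / 2 : ℝ) < 1)
    have hfin : {p : ℕ × ℤ | p.1 < K ∧ (dyadicCell p.1 p.2 ∩ ball x d).Nonempty}.Finite := by
      have : {p : ℕ × ℤ | p.1 < K ∧ (dyadicCell p.1 p.2 ∩ ball x d).Nonempty} ⊆
          ⋃ k ∈ Iio K, Prod.mk k '' {i | (dyadicCell k i ∩ ball x d).Nonempty} := by
        rintro ⟨k, i⟩ ⟨hk, hi⟩
        exact mem_biUnion (show k ∈ Iio K from hk) ⟨i, hi, rfl⟩
      exact ((finite_Iio K).biUnion fun k _ =>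
        (finite_setOf_dyadicCell_inter_ball_nonempty k x d).image _).subset this
    set c : ℕ × ℤ → ENNReal := fun p =>
      volume (whitneyCell F p.1 p.2 ∩ U) * (volume (Z p.1 p.2))⁻¹ with hc
    have hct : ∀ p, c p ≠ ⊤ := by
      intro p
      rcases (whitneyCell F p.1 p.2 ∩ U).eq_empty_or_nonempty with h | h
      · simp [hc, h]
      · exact ENNReal.mul_ne_top (measure_ne_top_of_subset inter_subset_right hUt)
          (ENNReal.inv_ne_top.2 (hZ0 _ _ h))
    refine ⟨(∑ p ∈ hfin.toFinset, c p) * 2, ENNReal.mul_ne_top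
      (ENNReal.sum_ne_top.2 fun p _ => hct p) (by norm_num), d / 2, by positivity, ?_⟩
    intro r hr hrd
    rw [transportedVolume_apply F U Z measurableSet_ball]
    have h0 : ball x r ∩ (F ∩ U) = ∅ := by
      rw [eq_empty_iff_forall_notMem]
      rintro y ⟨hy, hyF, -⟩
      rw [mem_ball, dist_comm, Real.dist_eq] at hy
      linarith [hdF y hyF]
    rw [h0, measure_empty, zero_add, tsum_eq_sum (s := hfin.toFinset)]
    · rw [mul_assoc, Finset.sum_mul]
      refine Finset.sum_le_sum fun p _ => ?_
      rw [ProbabilityTheory.cond_apply' measurableSet_ball, hc, mul_assoc]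
      gcongr
      refine (measure_mono inter_subset_right).trans_eq ?_
      rw [Real.volume_ball, ENNReal.ofReal_mul (by norm_num)]
      norm_num
    · rintro ⟨k, i⟩ hp
      rw [ProbabilityTheory.cond_apply' measurableSet_ball]
      rcases (whitneyCell F k i ∩ U).eq_empty_or_nonempty with h | ⟨y, hy, -⟩
      · simp [h]
      suffices hempty : Z k i ∩ ball x r = ∅ by simp [hempty]
      rw [eq_empty_iff_forall_notMem]
      rintro z ⟨hz, hzx⟩
      apply hp
      rw [Finite.mem_toFinset]
      refine ⟨?_, z, hZs k i hz, ball_subset_ball (by linarith) hzx⟩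
      by_contra! hk
      have h1 := abs_sub_lt_of_mem_dyadicCell (hZs k i hz) hy.1
      obtain ⟨w, hw, hyw⟩ := mem_thickening_iff.1 hy.2.1
      rw [mem_ball, dist_comm, Real.dist_eq] at hzx
      rw [Real.dist_eq] at hyw
      have h2 := hdF w hw
      have h3 := abs_sub_le x z w
      have h4 := abs_sub_le z y w
      have h5 : (1 / 2 : ℝ) ^ k ≤ (1 / 2) ^ K :=
        pow_le_pow_of_le_one (by norm_num) (by norm_num) hk
      linarith

/-- A null set has an open neighbourhood off a closed set `P` that is uniformly thin at every
point of `P`. -/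
theorem exists_isOpen_thin {A F P : Set ℝ} (hA : volume A = 0) (hP : IsClosed P)
    {ε η : ℝ} (hε : 0 < ε) (hη : 0 < η) :
    ∃ U : Set ℝ, IsOpen U ∧ (A ∩ F) \ P ⊆ U ∧ U ⊆ thickening η F ∧ volume U ≤ ENNReal.ofReal ε ∧
      (∀ y ∈ U, ∀ p ∈ P, ∃ x ∈ F, |y - x| < |y - p|) ∧
      ∀ p ∈ P, ∀ r, 0 < r → volume (U ∩ ball p r) ≤ ENNReal.ofReal (ε * r) := by
  have hex : ∀ n : ℕ, ∃ V ⊇ A, IsOpen V ∧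
      volume V < ENNReal.ofReal (ε * (1 / 2) ^ (n + 1) * (1 / (n + 1))) := fun n =>
    A.exists_isOpen_lt_of_lt _ (by rw [hA, ENNReal.ofReal_pos]; positivity)
  choose V hAV hVo hVlt using hex
  set ρ : ℕ → ENNReal := fun n => ENNReal.ofReal (1 / (n + 1)) with hρ
  set G : Set ℝ := {y | infEDist y F < infEDist y P} ∩ thickening η F with hG
  have hGo : IsOpen G :=
    (isOpen_lt continuous_infEDist continuous_infEDist).inter isOpen_thickening
  set D : ℕ → Set ℝ := fun n => {y | ρ n < infEDist y P} with hD
  have hDo : ∀ n, IsOpen (D n) := fun n => isOpen_lt continuous_const continuous_infEDist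
  have hVle : ∀ n, volume (V n ∩ D n) ≤
      ENNReal.ofReal (ε * (1 / 2) ^ (n + 1) * (1 / (n + 1))) := fun n =>
    (measure_mono inter_subset_left).trans (hVlt n).le
  have hsum : ∀ t : ℝ, 0 ≤ t →
      ∑' n : ℕ, ENNReal.ofReal (ε * (1 / 2) ^ (n + 1) * t) = ENNReal.ofReal (ε * t) := by
    intro t ht
    have hs : HasSum (fun n : ℕ => ε * (1 / 2 : ℝ) ^ (n + 1) * t) (ε * t) := by
      have he : (fun n : ℕ => ε * (1 / 2 : ℝ) ^ (n + 1) * t) =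
          fun n : ℕ => ε * t * (1 / 2) * (1 / 2) ^ n := by
        ext n
        ring
      have h2 : ε * t * (1 / 2) * 2 = ε * t := by ring
      have h := hasSum_geometric_two.mul_left (ε * t * (1 / 2))
      rw [h2] at h
      rwa [he]
    rw [← ENNReal.ofReal_tsum_of_nonneg (fun n => by positivity) hs.summable, hs.tsum_eq]
  refine ⟨(⋃ n, V n ∩ D n) ∩ G, (isOpen_iUnion fun n => (hVo n).inter (hDo n)).inter hGo,
    ?_, fun y hy => hy.2.2, ?_, ?_, ?_⟩
  · rintro y ⟨⟨hyA, hyF⟩, hyP⟩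
    have hpos : 0 < infEDist y P := by
      rw [pos_iff_ne_zero]
      exact fun h => hyP ((mem_iff_infEDist_zero_of_closed hP).2 h)
    refine ⟨?_, ?_, self_subset_thickening hη F hyF⟩
    · obtain ⟨t, ht0, ht⟩ := ENNReal.lt_iff_exists_nnreal_btwn.1 hpos
      obtain ⟨n, hn⟩ := exists_nat_one_div_lt (show (0 : ℝ) < t by exact_mod_cast ht0)
      refine mem_iUnion.2 ⟨n, hAV n hyA, lt_trans ?_ ht⟩
      rw [hρ, ← ENNReal.ofReal_coe_nnreal]
      exact (ENNReal.ofReal_lt_ofReal_iff (lt_trans (by positivity) hn)).2 hn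
    · change infEDist y F < infEDist y P
      rwa [infEDist_zero_of_mem hyF]
  · refine (measure_mono inter_subset_left).trans ((measure_iUnion_le _).trans ?_)
    calc _ ≤ ∑' n : ℕ, ENNReal.ofReal (ε * (1 / 2) ^ (n + 1) * 1) := by
          refine ENNReal.tsum_le_tsum fun n => (hVle n).trans (ENNReal.ofReal_le_ofReal ?_)
          gcongr
          rw [div_le_one (by positivity)]
          linarith [(Nat.cast_nonneg n : (0 : ℝ) ≤ n)]
      _ = ENNReal.ofReal ε := by rw [hsum 1 zero_le_one, mul_one]
  · intro y hy p hp
    have h : infEDist y F < edist y p := lt_of_lt_of_le hy.2.1 (infEDist_le_edist_of_mem hp)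
    obtain ⟨x, hx, hyx⟩ := infEDist_lt_iff.1 h
    refine ⟨x, hx, ?_⟩
    rwa [edist_dist, edist_dist, ENNReal.ofReal_lt_ofReal_iff_of_nonneg dist_nonneg] at hyx
  · intro p hp r hr
    have hsub : (⋃ n, V n ∩ D n) ∩ G ∩ ball p r ⊆ ⋃ n, V n ∩ D n ∩ ball p r := by
      rintro y ⟨⟨hy, -⟩, hyp⟩
      obtain ⟨n, hn⟩ := mem_iUnion.1 hy
      exact mem_iUnion.2 ⟨n, hn, hyp⟩
    refine (measure_mono hsub).trans ((measure_iUnion_le _).trans ?_)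
    rw [← hsum r hr.le]
    refine ENNReal.tsum_le_tsum fun n => ?_
    rcases (V n ∩ D n ∩ ball p r).eq_empty_or_nonempty with h | ⟨y, ⟨-, hyD⟩, hyp⟩
    · simp [h]
    · refine (measure_mono inter_subset_left).trans
        ((hVle n).trans (ENNReal.ofReal_le_ofReal ?_))
      have h1 : ρ n < edist y p := lt_of_lt_of_le hyD (infEDist_le_edist_of_mem hp)
      rw [hρ, edist_dist, ENNReal.ofReal_lt_ofReal_iff_of_nonneg (by positivity)] at h1
      gcongr
      exact (h1.trans hyp).le

section Distribution

variable {μ : Measure ℝ} [IsFiniteMeasure μ]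

theorem measureReal_Iic_sub_measureReal_Iic (hμ : μ ≪ volume) {x y : ℝ} (hxy : x ≤ y) :
    μ.real (Iic y) - μ.real (Iic x) = μ.real (Ioo x y) := by
  have : NullSingletonClass μ := ⟨fun z => hμ (measure_singleton z)⟩
  rw [measureReal_congr Ioo_ae_eq_Ioc, ← Iic_sdiff_Iic,
    measureReal_sdiff (Iic_subset_Iic.2 hxy) measurableSet_Iic]

theorem absCont_measureReal_Iic_s19 (hμ : μ ≪ volume) : AbsCont fun x => μ.real (Iic x) := by
  intro ε hε
  have hμd : volume.withDensity (μ.rnDeriv volume) = μ := Measure.withDensity_rnDeriv_eq _ _ hμ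
  obtain ⟨δ, hδ, hδμ⟩ := exists_pos_setLIntegral_lt_of_measure_lt
    (Measure.lintegral_rnDeriv_lt_top μ volume).ne (ENNReal.ofReal_pos.2 hε).ne'
  obtain ⟨η, hη0, hηδ⟩ := ENNReal.lt_iff_exists_nnreal_btwn.1 hδ
  refine ⟨η, by exact_mod_cast hη0, fun n a b hab hdisj hlen => ?_⟩
  have hmeas : MeasurableSet (⋃ i, Ioo (a i) (b i)) := .iUnion fun _ => measurableSet_Ioo
  calc ∑ i, |μ.real (Iic (b i)) - μ.real (Iic (a i))| = ∑ i, μ.real (Ioo (a i) (b i)) :=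
        Finset.sum_congr rfl fun i _ => by
          rw [measureReal_Iic_sub_measureReal_Iic hμ (hab i), abs_of_nonneg measureReal_nonneg]
    _ = μ.real (⋃ i, Ioo (a i) (b i)) :=
        (measureReal_iUnion_fintype hdisj fun _ => measurableSet_Ioo).symm
    _ < ε := by
        refine ENNReal.toReal_lt_of_lt_ofReal ?_
        rw [← hμd, withDensity_apply _ hmeas]
        refine hδμ _ (lt_of_le_of_lt ?_ hηδ)
        refine (measure_iUnion_le _).trans ?_
        simp only [Real.volume_Ioo, tsum_fintype]
        rw [← ENNReal.ofReal_sum_of_nonneg fun i _ => sub_nonneg.2 (hab i),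
          ← ENNReal.ofReal_coe_nnreal]
        exact ENNReal.ofReal_le_ofReal hlen.le

theorem tendsto_slope_measureReal_Iic_atTop (hμ : μ ≪ volume) {x : ℝ}
    (h : ∀ N : ℕ, ∃ δ > 0, ∀ r, 0 < r → r < δ →
      ENNReal.ofReal (N * r) ≤ μ (Ioo x (x + r)) ∧
      ENNReal.ofReal (N * r) ≤ μ (Ioo (x - r) x)) :
    Tendsto (fun y => (μ.real (Iic y) - μ.real (Iic x)) / (y - x)) (𝓝[≠] x) atTop := by
  refine tendsto_atTop.2 fun b => ?_
  obtain ⟨N, hN⟩ := exists_nat_ge b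
  obtain ⟨δ, hδ, hδμ⟩ := h N
  filter_upwards [mem_nhdsWithin_of_mem_nhds (ball_mem_nhds x hδ), self_mem_nhdsWithin]
    with y hy hyx
  rw [mem_ball, Real.dist_eq] at hy
  refine hN.trans ?_
  rcases lt_or_gt_of_ne (show y ≠ x from hyx) with hlt | hlt
  · have h1 := (hδμ (x - y) (by linarith) (by rwa [abs_of_neg (by linarith), neg_sub] at hy)).2
    rw [sub_sub_cancel, ENNReal.ofReal_le_iff_le_toReal (measure_ne_top _ _)] at h1
    rw [← neg_sub, ← neg_sub x y, neg_div_neg_eq,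
      measureReal_Iic_sub_measureReal_Iic hμ hlt.le, le_div_iff₀ (by linarith)]
    exact h1
  · have h1 := (hδμ (y - x) (by linarith) (by rwa [abs_of_pos (by linarith)] at hy)).1
    rw [add_sub_cancel, ENNReal.ofReal_le_iff_le_toReal (measure_ne_top _ _)] at h1
    rw [measureReal_Iic_sub_measureReal_Iic hμ hlt.le, le_div_iff₀ (by linarith)]
    exact h1

theorem lipInf_eq_top_of_tendsto_slope_atTop {g : ℝ → ℝ} {x : ℝ}
    (h : Tendsto (fun y => (g y - g x) / (y - x)) (𝓝[≠] x) atTop) : lipInf g x = ⊤ := by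
  refine ENNReal.eq_top_of_forall_nnreal_le fun b => ?_
  refine le_liminf_of_le (by isBoundedDefault) ?_
  have hlim : Tendsto (fun r : ℝ => x + r / 2) (𝓝[>] 0) (𝓝[≠] x) := by
    refine tendsto_nhdsWithin_iff.2 ⟨?_, ?_⟩
    · have : Tendsto (fun r : ℝ => x + r / 2) (𝓝 0) (𝓝 (x + 0 / 2)) :=
        (Continuous.tendsto (by fun_prop) 0)
      rw [zero_div, add_zero] at this
      exact this.mono_left nhdsWithin_le_nhds
    · filter_upwards [self_mem_nhdsWithin] with r hr
      have hr : (0 : ℝ) < r := hr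
      exact (by linarith : x < x + r / 2).ne'
  filter_upwards [hlim.eventually (h.eventually_ge_atTop (2 * b)), self_mem_nhdsWithin] with r h1 hr
  have hr : (0 : ℝ) < r := hr
  rw [add_sub_cancel_left] at h1
  have hmem : x + r / 2 ∈ ball x r := by
    rw [mem_ball, Real.dist_eq, add_sub_cancel_left, abs_of_pos (by linarith)]
    linarith
  refine le_trans ?_ (le_iSup₂ (f := fun y (_ : y ∈ ball x r) =>
    ENNReal.ofReal (|g y - g x| / r)) (x + r / 2) hmem)
  rw [← ENNReal.ofReal_coe_nnreal]
  refine ENNReal.ofReal_le_ofReal ?_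
  rw [le_div_iff₀ (by linarith)] at h1 ⊢
  refine le_trans ?_ (le_abs_self _)
  linarith

theorem lipInf_measureReal_Iic_lt_top (hμ : μ ≪ volume) {x : ℝ} {C : ENNReal} (hC : C ≠ ⊤)
    (h : ∀ δ > 0, ∃ r, 0 < r ∧ r < δ ∧ μ (ball x r) ≤ C * ENNReal.ofReal r) :
    lipInf (fun y => μ.real (Iic y)) x < ⊤ := by
  refine lt_of_le_of_lt (Filter.liminf_le_of_frequently_le' ?_) hC.lt_top
  rw [(nhdsGT_basis (0 : ℝ)).frequently_iff]
  intro δ hδ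
  obtain ⟨r, hr, hrδ, hrC⟩ := h δ hδ
  refine ⟨r, ⟨hr, hrδ⟩, iSup₂_le fun y hy => ?_⟩
  have key : |μ.real (Iic y) - μ.real (Iic x)| ≤ μ.real (ball x r) := by
    rw [Real.ball_eq_Ioo] at hy ⊢
    rcases le_total x y with hxy | hxy
    · rw [measureReal_Iic_sub_measureReal_Iic hμ hxy, abs_of_nonneg measureReal_nonneg]
      exact measureReal_mono (Ioo_subset_Ioo (by linarith) hy.2.le)
    · rw [abs_sub_comm, measureReal_Iic_sub_measureReal_Iic hμ hxy,
        abs_of_nonneg measureReal_nonneg]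
      exact measureReal_mono (Ioo_subset_Ioo hy.1.le (by linarith))
  rw [ENNReal.ofReal_div_of_pos hr]
  refine ENNReal.div_le_of_le_mul (le_trans ?_ hrC)
  rw [← ofReal_measureReal (μ := μ) (s := ball x r)]
  exact ENNReal.ofReal_le_ofReal key

end Distribution

open Classical in
/-- A compact subset of positive measure of the part of `C` outside `A` in a dyadic interval,
if there is one. -/
noncomputable def pickCompact (A C : Set ℝ) (k : ℕ) (i : ℤ) : Set ℝ :=
  if h : ∃ K : Set ℝ, IsCompact K ∧ K ⊆ (dyadicCell k i ∩ C) \ A ∧ volume K ≠ 0 then h.choose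
  else ∅

theorem isCompact_pickCompact (A C : Set ℝ) (k : ℕ) (i : ℤ) : IsCompact (pickCompact A C k i) := by
  unfold pickCompact
  split_ifs with h
  · exact h.choose_spec.1
  · exact isCompact_empty

theorem pickCompact_subset (A C : Set ℝ) (k : ℕ) (i : ℤ) :
    pickCompact A C k i ⊆ (dyadicCell k i ∩ C) \ A := by
  unfold pickCompact
  split_ifs with h
  · exact h.choose_spec.2.1
  · exact empty_subset _

theorem volume_pickCompact_ne_zero {A C : Set ℝ} (hA : MeasurableSet A) (hA0 : volume A = 0)
    (hC : IsClosed C) {k : ℕ} {i : ℤ} (h : volume (dyadicCell k i ∩ C) ≠ 0) :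
    volume (pickCompact A C k i) ≠ 0 := by
  have hex : ∃ K : Set ℝ, IsCompact K ∧ K ⊆ (dyadicCell k i ∩ C) \ A ∧ volume K ≠ 0 := by
    have hpos : 0 < volume ((dyadicCell k i ∩ C) \ A) := by
      rw [measure_sdiff_null hA0]
      exact pos_iff_ne_zero.2 h
    obtain ⟨K, hKs, hKc, hK⟩ := (((measurableSet_dyadicCell k i).inter
      hC.measurableSet).diff hA).exists_lt_isCompact hpos
    exact ⟨K, hKc, hKs, hK.ne'⟩
  unfold pickCompact
  rw [dif_pos hex]
  exact hex.choose_spec.2.2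

/-- The set `F` together with compact pieces of `C` outside `A` in all dyadic intervals of length
at most `2 ^ (-n)` that are close to `F`. -/
def enlarge (A C F : Set ℝ) (n : ℕ) : Set ℝ :=
  F ∪ ⋃ (k : ℕ) (i : ℤ) (_ : n ≤ k ∧ (dyadicCell k i ∩ thickening (4 * (1 / 2) ^ k) F).Nonempty),
    pickCompact A C k i

theorem pickCompact_subset_enlarge (A C F : Set ℝ) {n k : ℕ} {i : ℤ} (hk : n ≤ k)
    (h : (dyadicCell k i ∩ thickening (4 * (1 / 2) ^ k) F).Nonempty) :
    pickCompact A C k i ⊆ enlarge A C F n := fun _ hy =>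
  Or.inr (mem_iUnion₂.2 ⟨k, i, mem_iUnion.2 ⟨⟨hk, h⟩, hy⟩⟩)

theorem enlarge_subset {A C F : Set ℝ} (hFC : F ⊆ C) (n : ℕ) : enlarge A C F n ⊆ C :=
  union_subset hFC (iUnion₂_subset fun k i => iUnion_subset fun _ _ hy =>
    (pickCompact_subset A C k i hy).1.2)

theorem inter_enlarge_subset (A C F : Set ℝ) (n : ℕ) : A ∩ enlarge A C F n ⊆ F := by
  rintro y ⟨hyA, hy | hy⟩
  · exact hy
  · obtain ⟨k, i, h⟩ := mem_iUnion₂.1 hy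
    obtain ⟨-, h⟩ := mem_iUnion.1 h
    exact absurd hyA (pickCompact_subset A C k i h).2

theorem mem_thickening_of_mem_pickCompact {A C F : Set ℝ} {k : ℕ} {i : ℤ} {y : ℝ}
    (hy : y ∈ pickCompact A C k i)
    (h : (dyadicCell k i ∩ thickening (4 * (1 / 2) ^ k) F).Nonempty) :
    y ∈ thickening (5 * (1 / 2) ^ k) F := by
  obtain ⟨z, hz, hzF⟩ := h
  obtain ⟨x, hx, hzx⟩ := mem_thickening_iff.1 hzF
  refine mem_thickening_iff.2 ⟨x, hx, ?_⟩
  have h1 : dist y z < (1 / 2) ^ k :=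
    abs_sub_lt_of_mem_dyadicCell (pickCompact_subset A C k i hy).1.1 hz
  linarith [dist_triangle y z x]

theorem five_mul_half_pow_anti {k l : ℕ} (h : k ≤ l) :
    5 * (1 / 2 : ℝ) ^ l ≤ 5 * (1 / 2) ^ k := by
  have := pow_le_pow_of_le_one (by norm_num : (0 : ℝ) ≤ 1 / 2) (by norm_num) h
  linarith

theorem enlarge_subset_thickening (A C F : Set ℝ) (n : ℕ) :
    enlarge A C F n ⊆ thickening (5 * (1 / 2) ^ n) F := by
  rintro y (hy | hy)
  · exact self_subset_thickening (by positivity) F hy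
  · obtain ⟨k, i, h⟩ := mem_iUnion₂.1 hy
    obtain ⟨⟨hk, hne⟩, h⟩ := mem_iUnion.1 h
    exact thickening_mono (five_mul_half_pow_anti hk) F (mem_thickening_of_mem_pickCompact h hne)

theorem mem_of_forall_mem_thickening {F : Set ℝ} (hF : IsClosed F) {y : ℝ} {N : ℕ}
    (h : ∀ k, N ≤ k → y ∈ thickening (5 * (1 / 2) ^ k) F) : y ∈ F := by
  rw [← hF.closure_eq, Metric.mem_closure_iff]
  intro ε hε
  obtain ⟨k, hk⟩ := exists_pow_lt_of_lt_one (by positivity : 0 < ε / 5)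
    (by norm_num : (1 / 2 : ℝ) < 1)
  obtain ⟨z, hz, hyz⟩ := mem_thickening_iff.1 (h (N + k) (by omega))
  refine ⟨z, hz, hyz.trans_le ?_⟩
  linarith [five_mul_half_pow_anti (show k ≤ N + k by omega)]

theorem isClosed_enlarge {A C F : Set ℝ} (hF : IsClosed F) (n : ℕ) :
    IsClosed (enlarge A C F n) := by
  set T : ℕ → ℤ → Set ℝ := fun k i =>
    ⋃ (_ : n ≤ k ∧ (dyadicCell k i ∩ thickening (4 * (1 / 2) ^ k) F).Nonempty),
      pickCompact A C k i with hT
  have hTc : ∀ k i, IsClosed (T k i) := fun k i =>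
    isClosed_iUnion_of_finite fun _ => (isCompact_pickCompact A C k i).isClosed
  have hTs : ∀ k i, T k i ⊆ dyadicCell k i := fun k i =>
    iUnion_subset fun _ _ hy => (pickCompact_subset A C k i hy).1.1
  have hTk : ∀ k, IsClosed (⋃ i, T k i) := fun k =>
    ((locallyFinite_dyadicCell k).subset (hTs k)).isClosed_iUnion (hTc k)
  have heq : enlarge A C F n =
      ⋂ K : ℕ, (cthickening (5 * (1 / 2) ^ K) F ∪ ⋃ k ∈ Iio K, ⋃ i, T k i) := by
    apply subset_antisymm
    · rintro y (hy | hy)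
      · exact mem_iInter.2 fun K => Or.inl (self_subset_cthickening F hy)
      · refine mem_iInter.2 fun K => ?_
        obtain ⟨k, i, h⟩ := mem_iUnion₂.1 hy
        obtain ⟨⟨hk, hne⟩, h'⟩ := mem_iUnion.1 h
        rcases lt_or_ge k K with hkK | hkK
        · exact Or.inr (mem_biUnion hkK (mem_iUnion.2 ⟨i, h⟩))
        · exact Or.inl (thickening_subset_cthickening _ _
            (thickening_mono (five_mul_half_pow_anti hkK) F
              (mem_thickening_of_mem_pickCompact h' hne)))
    · intro y hy
      by_cases hyT : ∃ k i, y ∈ T k i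
      · obtain ⟨k, i, h⟩ := hyT
        exact Or.inr (mem_iUnion₂.2 ⟨k, i, h⟩)
      · left
        refine mem_of_forall_mem_thickening hF (N := 0) fun k _ => ?_
        rcases mem_iInter.1 hy (k + 1) with h | h
        · refine cthickening_subset_thickening' (by positivity) ?_ F h
          rw [pow_succ]
          have : (0 : ℝ) < (1 / 2) ^ k := by positivity
          linarith
        · obtain ⟨l, -, h⟩ := mem_iUnion₂.1 h
          obtain ⟨i, h⟩ := mem_iUnion.1 h
          exact absurd ⟨l, i, h⟩ hyT
  rw [heq]
  exact isClosed_iInter fun K => isClosed_cthickening.union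
    ((finite_Iio K).isClosed_biUnion fun k _ => hTk k)

/-- The intersection of the sets `B n m` along a finite sequence, listed from its last term. -/
def branchSet (B : ℕ → ℕ → Set ℝ) : List ℕ → Set ℝ
  | [] => univ
  | m :: τ => branchSet B τ ∩ B τ.length m

/-- A decreasing scheme of closed sets enlarging `branchSet`, without new points of `A`. -/
def hullSet (A : Set ℝ) (B : ℕ → ℕ → Set ℝ) : List ℕ → Set ℝ
  | [] => univ
  | m :: τ => enlarge A (hullSet A B τ) (branchSet B (m :: τ)) (τ.length + 1)

/-- The union of the hulls that branch off to the left of a finite sequence. -/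
def leftSet (A : Set ℝ) (B : ℕ → ℕ → Set ℝ) : List ℕ → Set ℝ
  | [] => ∅
  | m :: τ => leftSet A B τ ∪ ⋃ j ∈ Iio m, hullSet A B (j :: τ)

section Scheme

variable {A : Set ℝ} {B : ℕ → ℕ → Set ℝ}

theorem isClosed_branchSet (hB : ∀ n m, IsClosed (B n m)) : ∀ σ, IsClosed (branchSet B σ)
  | [] => isClosed_univ
  | _ :: τ => (isClosed_branchSet hB τ).inter (hB _ _)

theorem isClosed_hullSet (hB : ∀ n m, IsClosed (B n m)) : ∀ σ, IsClosed (hullSet A B σ)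
  | [] => isClosed_univ
  | _ :: _ => isClosed_enlarge (isClosed_branchSet hB _) _

theorem isClosed_leftSet (hB : ∀ n m, IsClosed (B n m)) : ∀ σ, IsClosed (leftSet A B σ)
  | [] => isClosed_empty
  | m :: τ => (isClosed_leftSet hB τ).union
      ((finite_Iio m).isClosed_biUnion fun j _ => isClosed_hullSet hB (j :: τ))

theorem branchSet_subset_hullSet : ∀ σ, branchSet B σ ⊆ hullSet A B σ
  | [] => subset_rfl
  | _ :: _ => subset_union_left

theorem hullSet_cons_subset (m : ℕ) (τ : List ℕ) : hullSet A B (m :: τ) ⊆ hullSet A B τ :=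
  enlarge_subset (inter_subset_left.trans (branchSet_subset_hullSet τ)) _

theorem hullSet_subset_of_suffix {σ τ : List ℕ} (h : σ <:+ τ) :
    hullSet A B τ ⊆ hullSet A B σ := by
  induction τ with
  | nil => rw [List.suffix_nil.1 h]
  | cons m τ ih =>
    rcases List.suffix_cons_iff.1 h with rfl | h
    · exact subset_rfl
    · exact (hullSet_cons_subset m τ).trans (ih h)

theorem leftSet_subset_of_suffix {σ τ : List ℕ} (h : σ <:+ τ) :
    leftSet A B σ ⊆ leftSet A B τ := by
  induction τ with
  | nil => rw [List.suffix_nil.1 h]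
  | cons m τ ih =>
    rcases List.suffix_cons_iff.1 h with rfl | h
    · exact subset_rfl
    · exact (ih h).trans subset_union_left

theorem hullSet_subset_leftSet {i j : ℕ} (h : i < j) (τ : List ℕ) :
    hullSet A B (i :: τ) ⊆ leftSet A B (j :: τ) :=
  fun _ hy => Or.inr (mem_biUnion (show i ∈ Iio j from h) hy)

theorem inter_hullSet_subset : ∀ σ, A ∩ hullSet A B σ ⊆ branchSet B σ
  | [] => subset_univ _
  | _ :: _ => inter_enlarge_subset _ _ _ _

theorem hullSet_subset_thickening : ∀ σ : List ℕ,
    hullSet A B σ ⊆ thickening (5 * (1 / 2) ^ σ.length) (branchSet B σ)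
  | [] => self_subset_thickening (by positivity) _
  | _ :: _ => enlarge_subset_thickening _ _ _ _

/-- Two finite sequences are comparable, or one of them branches off to the left. -/
theorem suffix_or_hullSet_subset_leftSet (σ τ : List ℕ) :
    τ <:+ σ ∨ hullSet A B τ ⊆ leftSet A B σ ∨ hullSet A B σ ⊆ leftSet A B τ ∨
      ∃ j, (j :: σ) <:+ τ := by
  have hext : ∀ σ τ : List ℕ, σ <:+ τ → τ <:+ σ ∨ ∃ j, (j :: σ) <:+ τ := by
    rintro σ τ ⟨ρ, rfl⟩
    rcases List.eq_nil_or_concat ρ with rfl | ⟨ρ', j, rfl⟩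
    · exact Or.inl (List.suffix_refl _)
    · exact Or.inr ⟨j, ρ', by simp⟩
  induction σ with
  | nil =>
    rcases hext [] τ (List.nil_suffix) with h | h
    · exact Or.inl h
    · exact Or.inr (Or.inr (Or.inr h))
  | cons m ρ ih =>
    rcases ih with h | h | h | ⟨j, h⟩
    · exact Or.inl (h.trans (List.suffix_cons m ρ))
    · exact Or.inr (Or.inl (h.trans subset_union_left))
    · exact Or.inr (Or.inr (Or.inl ((hullSet_cons_subset m ρ).trans h)))
    · rcases lt_trichotomy j m with hj | rfl | hj
      · exact Or.inr (Or.inl ((hullSet_subset_of_suffix h).trans (hullSet_subset_leftSet hj ρ)))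
      · rcases hext _ _ h with h | h
        · exact Or.inl h
        · exact Or.inr (Or.inr (Or.inr h))
      · exact Or.inr (Or.inr (Or.inl
          ((hullSet_subset_leftSet hj ρ).trans (leftSet_subset_of_suffix h))))

theorem volume_dyadicCell_inter_hullSet_ne_zero (hB : ∀ n m, IsClosed (B n m))
    (hA : MeasurableSet A) (hA0 : volume A = 0) : ∀ (σ : List ℕ) {k : ℕ} {i : ℤ},
    σ.length ≤ k → (dyadicCell k i ∩ thickening (4 * (1 / 2) ^ k) (branchSet B σ)).Nonempty →
      volume (dyadicCell k i ∩ hullSet A B σ) ≠ 0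
  | [], k, i, _, _ => by
    rw [hullSet, inter_univ]
    exact volume_dyadicCell_ne_zero k i
  | m :: τ, k, i, hk, h => by
    rw [List.length_cons] at hk
    have hτ := volume_dyadicCell_inter_hullSet_ne_zero hB hA hA0 τ (k := k) (i := i) (by omega)
      (h.mono (inter_subset_inter_right _ (thickening_subset_of_subset _ inter_subset_left)))
    have hpick := volume_pickCompact_ne_zero hA hA0 (isClosed_hullSet hB τ) hτ
    have hsub : pickCompact A (hullSet A B τ) k i ⊆ dyadicCell k i ∩ hullSet A B (m :: τ) :=
      fun y hy => ⟨(pickCompact_subset _ _ _ _ hy).1.1,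
        pickCompact_subset_enlarge _ _ _ hk h hy⟩
    exact fun h0 => hpick (measure_mono_null hsub h0)

theorem volume_pickCompact_tail_ne_zero (hB : ∀ n m, IsClosed (B n m))
    (hA : MeasurableSet A) (hA0 : volume A = 0) (σ : List ℕ) {k : ℕ} {i : ℤ}
    (hk : σ.length ≤ k)
    (h : (dyadicCell k i ∩ thickening (4 * (1 / 2) ^ k) (branchSet B σ)).Nonempty) :
    volume (pickCompact A (hullSet A B σ.tail) k i) ≠ 0 ∧
      pickCompact A (hullSet A B σ.tail) k i ⊆ hullSet A B σ := by
  have hsub : branchSet B σ ⊆ branchSet B σ.tail := by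
    cases σ with
    | nil => exact subset_rfl
    | cons m τ => exact inter_subset_left
  refine ⟨volume_pickCompact_ne_zero hA hA0 (isClosed_hullSet hB _)
    (volume_dyadicCell_inter_hullSet_ne_zero hB hA hA0 _ (by rw [List.length_tail]; omega)
      (h.mono (inter_subset_inter_right _ (thickening_subset_of_subset _ hsub)))), ?_⟩
  cases σ with
  | nil => exact subset_univ _
  | cons m τ => exact pickCompact_subset_enlarge _ _ _ hk h

/-- The measure attached to a finite sequence: it is carried by the hull, has density bounded
below at the points of `A` in the branch set, and is small at all the hulls to the left. -/
theorem exists_layer (hB : ∀ n m, IsClosed (B n m)) (hA : MeasurableSet A) (hA0 : volume A = 0)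
    (σ : List ℕ) {ε : ℝ} (hε : 0 < ε) :
    ∃ ν : Measure ℝ, ν ≪ volume ∧ ν univ ≤ ENNReal.ofReal ε ∧ ν (hullSet A B σ)ᶜ = 0 ∧
      (∀ p ∈ leftSet A B σ, ∀ r, 0 < r → ν (ball p r) ≤ ENNReal.ofReal (ε * (2 * r))) ∧
      (∀ x ∈ (A ∩ branchSet B σ) \ leftSet A B σ, ∃ δ > 0, ∀ r, 0 < r → r < δ →
        ENNReal.ofReal (r / 2) ≤ ν (Ioo x (x + r)) ∧
        ENNReal.ofReal (r / 2) ≤ ν (Ioo (x - r) x)) ∧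
      ∀ x, ∃ M : ENNReal, M ≠ ⊤ ∧ ∃ δ > 0, ∀ r, 0 < r → r < δ →
        ν (ball x r) ≤ M * ENNReal.ofReal r := by
  have hF := isClosed_branchSet hB σ
  obtain ⟨U, hUo, hAU, hUF, hUv, hUP, hUthin⟩ := exists_isOpen_thin (F := branchSet B σ) hA0
    (isClosed_leftSet (A := A) hB σ) hε (by positivity : (0 : ℝ) < 4 * (1 / 2) ^ σ.length)
  set F := branchSet B σ
  set Z : ℕ → ℤ → Set ℝ := pickCompact A (hullSet A B σ.tail) with hZdef
  have hZs : ∀ k i, Z k i ⊆ dyadicCell k i := fun k i y hy => (pickCompact_subset _ _ _ _ hy).1.1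
  have hspec : ∀ k i, (whitneyCell F k i ∩ U).Nonempty →
      volume (Z k i) ≠ 0 ∧ Z k i ⊆ hullSet A B σ := by
    rintro k i ⟨y, hy, hyU⟩
    exact volume_pickCompact_tail_ne_zero hB hA hA0 σ
      (le_of_mem_whitneyCell_of_mem_thickening hy (hUF hyU)) ⟨y, hy.1, hy.2.1⟩
  have hUt : volume U ≠ ⊤ := (hUv.trans_lt ENNReal.ofReal_lt_top).ne
  refine ⟨transportedVolume F U Z, transportedVolume_absolutelyContinuous _ _ _, ?_, ?_, ?_, ?_,
    exists_transportedVolume_ball_le hF hUo hZs (fun k i h => (hspec k i h).1) hUt⟩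
  · refine (transportedVolume_le hUo MeasurableSet.univ MeasurableSet.univ (subset_univ _)
      fun _ _ _ => subset_univ _).trans ?_
    rwa [inter_univ]
  · refine le_antisymm ((transportedVolume_le (S' := ∅) hUo
      (isClosed_hullSet hB σ).measurableSet.compl MeasurableSet.empty ?_ ?_).trans ?_) zero_le
    · exact fun y hy => hy.2 (branchSet_subset_hullSet σ hy.1)
    · rintro k i ⟨z, hz, hzC⟩ y hy
      exact hzC ((hspec k i ⟨y, hy⟩).2 hz)
    · simp
  · intro p hp r hr
    refine (transportedVolume_le (S' := ball p (2 * r)) hUo measurableSet_ball measurableSet_ball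
      (fun y hy => ball_subset_ball (by linarith) hy.2) ?_).trans
        (hUthin p hp (2 * r) (by linarith))
    rintro k i ⟨z, hz, hzp⟩ y ⟨hy, hyU⟩
    obtain ⟨x, hx, hyx⟩ := hUP y hyU p hp
    have h1 := two_mul_le_dist_of_mem_whitneyCell hy hx
    have h2 := abs_sub_lt_of_mem_dyadicCell hy.1 (hZs k i hz)
    rw [mem_ball, Real.dist_eq] at hzp ⊢
    linarith [abs_sub_le y z p]
  · rintro x ⟨⟨hxA, hxF⟩, hxP⟩
    obtain ⟨δ, hδ, hδU⟩ := Metric.isOpen_iff.1 hUo x (hAU ⟨⟨hxA, hxF⟩, hxP⟩)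
    rw [Real.ball_eq_Ioo] at hδU
    have hmove : ∀ {k i y z}, y ∈ whitneyCell F k i → z ∈ Z k i → |y - z| < |y - x| / 2 := by
      intro k i y z hy hz
      linarith [two_mul_le_dist_of_mem_whitneyCell hy hxF,
        abs_sub_lt_of_mem_dyadicCell hy.1 (hZs k i hz)]
    refine ⟨δ, hδ, fun r hr hrδ => ⟨?_, ?_⟩⟩
    · calc ENNReal.ofReal (r / 2) = volume (U ∩ Ioo x (x + r / 2)) := by
            rw [inter_eq_right.2 fun y hy => hδU ⟨by linarith [hy.1], by linarith [hy.2]⟩,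
              Real.volume_Ioo, add_sub_cancel_left]
        _ ≤ _ := by
            refine le_transportedVolume hF hUF (isCompact_pickCompact _ _)
              (fun k i h => (hspec k i h).1) measurableSet_Ioo
              (fun y hy => ⟨hy.2.1, by linarith [hy.2.2]⟩) ?_
            rintro k i ⟨y, hy, -, hyx⟩ z hz
            have h := hmove hy hz
            rw [abs_of_pos (sub_pos.2 hyx.1), abs_lt] at h
            exact ⟨by linarith [hyx.1, hyx.2], by linarith [hyx.1, hyx.2]⟩
    · calc ENNReal.ofReal (r / 2) = volume (U ∩ Ioo (x - r / 2) x) := by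
            rw [inter_eq_right.2 fun y hy => hδU ⟨by linarith [hy.1], by linarith [hy.2]⟩,
              Real.volume_Ioo, sub_sub_cancel]
        _ ≤ _ := by
            refine le_transportedVolume hF hUF (isCompact_pickCompact _ _)
              (fun k i h => (hspec k i h).1) measurableSet_Ioo
              (fun y hy => ⟨by linarith [hy.2.1], hy.2.2⟩) ?_
            rintro k i ⟨y, hy, -, hyx⟩ z hz
            have h := hmove hy hz
            rw [abs_of_neg (sub_neg.2 hyx.2), abs_lt] at h
            exact ⟨by linarith [hyx.1, hyx.2], by linarith [hyx.1, hyx.2]⟩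

theorem exists_mem_hullSet_cons {x : ℝ} {τ : List ℕ} (hx : x ∉ leftSet A B τ)
    (h : ∃ m, x ∈ hullSet A B (m :: τ)) :
    ∃ m, x ∈ hullSet A B (m :: τ) ∧ x ∉ leftSet A B (m :: τ) := by
  classical
  refine ⟨Nat.find h, Nat.find_spec h, ?_⟩
  rintro (hl | hl)
  · exact hx hl
  · obtain ⟨j, hj, hxj⟩ := mem_iUnion₂.1 hl
    exact Nat.find_min h hj hxj

theorem exists_mem_branchSet_notMem_leftSet (hAB : A = ⋂ n, ⋃ m, B n m) {x : ℝ} (hx : x ∈ A)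
    (n : ℕ) : ∃ σ : List ℕ, σ.length = n ∧ x ∈ branchSet B σ ∧ x ∉ leftSet A B σ := by
  induction n with
  | zero => exact ⟨[], rfl, mem_univ _, notMem_empty _⟩
  | succ n ih =>
    obtain ⟨τ, rfl, hτ, hτl⟩ := ih
    have hxB : x ∈ ⋂ n, ⋃ m, B n m := hAB ▸ hx
    obtain ⟨m, hm⟩ := mem_iUnion.1 (mem_iInter.1 hxB τ.length)
    obtain ⟨j, hj, hjl⟩ := exists_mem_hullSet_cons hτl
      ⟨m, branchSet_subset_hullSet (m :: τ) ⟨hτ, hm⟩⟩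
    exact ⟨j :: τ, rfl, inter_hullSet_subset _ ⟨hx, hj⟩, hjl⟩

/-- A point outside `A` is contained in a last hull of its leftmost branch. -/
theorem exists_mem_hullSet_forall_cons_notMem (hB : ∀ n m, IsClosed (B n m))
    (hAB : A = ⋂ n, ⋃ m, B n m) {x : ℝ} (hx : x ∉ A) :
    ∃ σ, x ∈ hullSet A B σ ∧ x ∉ leftSet A B σ ∧ ∀ m, x ∉ hullSet A B (m :: σ) := by
  by_contra! hcon
  choose! f hf using fun σ (hσ : x ∈ hullSet A B σ ∧ x ∉ leftSet A B σ) =>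
    exists_mem_hullSet_cons hσ.2 (hcon σ hσ.1 hσ.2)
  set S : ℕ → List ℕ := fun n => Nat.rec [] (fun _ σ => f σ :: σ) n with hSdef
  have hSsucc : ∀ n, S (n + 1) = f (S n) :: S n := fun n => rfl
  have hS : ∀ n, x ∈ hullSet A B (S n) ∧ x ∉ leftSet A B (S n) := by
    intro n
    induction n with
    | zero => exact ⟨mem_univ _, notMem_empty _⟩
    | succ n ih => exact hf _ ih
  have hlen : ∀ n, (S n).length = n := by
    intro n
    induction n with
    | zero => rfl
    | succ n ih => rw [hSsucc, List.length_cons, ih]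
  have hanti : Antitone fun n => branchSet B (S n) :=
    antitone_nat_of_succ_le fun n => inter_subset_left
  have hbranch : ∀ n, x ∈ branchSet B (S n) := fun n =>
    mem_of_forall_mem_thickening (isClosed_branchSet hB _) (N := n) fun k hk => by
      have h := hullSet_subset_thickening _ (hS k).1
      rw [hlen] at h
      exact thickening_subset_of_subset _ (hanti hk) h
  apply hx
  rw [hAB]
  refine mem_iInter.2 fun n => mem_iUnion.2 ⟨f (S n), ?_⟩
  have h := (hbranch (n + 1)).2
  rwa [hlen] at h

/-- Arbitrarily small radii at which the deeper hulls are either invisible or have a left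
neighbour at a comparable distance. -/
theorem exists_radius (hB : ∀ n m, IsClosed (B n m)) {x : ℝ} {σ : List ℕ}
    (hl : x ∉ leftSet A B σ) (hσ : ∀ m, x ∉ hullSet A B (m :: σ)) {δ : ℝ} (hδ : 0 < δ) :
    ∃ r, 0 < r ∧ r < δ ∧ Disjoint (ball x r) (leftSet A B σ) ∧
      ∀ τ j, (j :: σ) <:+ τ → Disjoint (ball x r) (hullSet A B τ) ∨
        ∃ q ∈ leftSet A B τ, dist x q ≤ r := by
  obtain ⟨d, hd, hdl⟩ := Metric.isOpen_iff.1 (isClosed_leftSet (A := A) hB σ).isOpen_compl x hl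
  have hdl : Disjoint (ball x d) (leftSet A B σ) := subset_compl_iff_disjoint_right.1 hdl
  set ρ := min d δ with hρdef
  have hρ : 0 < ρ := lt_min hd hδ
  by_cases hmeet : ∃ j, ¬ Disjoint (ball x ρ) (hullSet A B (j :: σ))
  · obtain ⟨j, hj⟩ := hmeet
    obtain ⟨z, hz, hzj⟩ := not_disjoint_iff.1 hj
    set Q := ⋃ i ∈ Iic j, hullSet A B (i :: σ) with hQ
    have hQc : IsClosed Q :=
      (finite_Iic j).isClosed_biUnion fun i _ => isClosed_hullSet hB (i :: σ)
    have hzQ : z ∈ Q := mem_biUnion self_mem_Iic hzj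
    have hxQ : x ∉ Q := fun h => by
      obtain ⟨i, -, hi⟩ := mem_iUnion₂.1 h
      exact hσ i hi
    obtain ⟨q, hqQ, hq⟩ := hQc.exists_infDist_eq_dist ⟨z, hzQ⟩ x
    have hqρ : dist x q < ρ := by
      rw [← hq]
      refine (infDist_le_dist_of_mem hzQ).trans_lt ?_
      rwa [dist_comm]
    have hdisj : Disjoint (ball x (dist x q)) Q := hq ▸ disjoint_ball_infDist
    refine ⟨dist x q, dist_pos.2 fun h => hxQ (h ▸ hqQ), hqρ.trans_le (min_le_right _ _),
      hdl.mono_left (ball_subset_ball (hqρ.le.trans (min_le_left _ _))), fun τ i hi => ?_⟩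
    rcases le_or_gt i j with hij | hij
    · exact Or.inl (hdisj.mono_right ((hullSet_subset_of_suffix hi).trans fun y hy =>
        mem_biUnion (show i ∈ Iic j from hij) hy))
    · obtain ⟨l, hlj, hql⟩ := mem_iUnion₂.1 hqQ
      exact Or.inr ⟨q, leftSet_subset_of_suffix hi
        (hullSet_subset_leftSet (lt_of_le_of_lt hlj hij) σ hql), le_rfl⟩
  · push Not at hmeet
    refine ⟨ρ / 2, by linarith, by linarith [min_le_right d δ],
      hdl.mono_left (ball_subset_ball (by linarith [min_le_left d δ])), fun τ i hi => Or.inl ?_⟩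
    exact (hmeet i).mono (ball_subset_ball (by linarith)) (hullSet_subset_of_suffix hi)

end Scheme

theorem main_result (A : Set ℝ)
    (hFsd : ∃ B : ℕ → ℕ → Set ℝ, (∀ n m, IsClosed (B n m)) ∧ A = ⋂ n, ⋃ m, B n m)
    (hnull : MeasureTheory.volume A = 0) :
    ∃ g : ℝ → ℝ, Monotone g ∧ AbsCont g ∧
      (∀ x ∈ A, Filter.Tendsto (fun y => (g y - g x) / (y - x))
          (nhdsWithin x {x}ᶜ) Filter.atTop ∧ lipInf g x = ⊤) ∧
      (∀ x ∉ A, lipInf g x < ⊤) := by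
  obtain ⟨B, hB, hAB⟩ := hFsd
  have hA : MeasurableSet A := by
    rw [hAB]
    exact .iInter fun n => .iUnion fun m => (hB n m).measurableSet
  obtain ⟨ε, hε, hεsum⟩ := ENNReal.exists_pos_sum_of_countable one_ne_zero (List ℕ)
  choose ν hac huniv hsupp hleft hlow hup using fun σ =>
    exists_layer hB hA hnull σ (ε := ε σ) (NNReal.coe_pos.2 (hε σ))
  set μ := Measure.sum ν with hμdef
  have hfin : IsFiniteMeasure μ := by
    refine ⟨?_⟩
    rw [hμdef, Measure.sum_apply _ MeasurableSet.univ]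
    refine lt_of_le_of_lt (ENNReal.tsum_le_tsum huniv) ?_
    simpa only [ENNReal.ofReal_coe_nnreal] using hεsum.trans ENNReal.one_lt_top
  have hμ : μ ≪ volume := Measure.absolutelyContinuous_sum_left hac
  refine ⟨fun x => μ.real (Iic x), fun x y hxy => measureReal_mono (Iic_subset_Iic.2 hxy),
    absCont_measureReal_Iic_s19 hμ, fun x hx => ?_, fun x hx => ?_⟩
  · have htend := tendsto_slope_measureReal_Iic_atTop hμ (x := x) ?_
    · exact ⟨htend, lipInf_eq_top_of_tendsto_slope_atTop htend⟩
    intro N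
    choose S hSlen hSmem hSleft using exists_mem_branchSet_notMem_leftSet hAB hx
    have hSinj : Function.Injective S := fun m n h => by rw [← hSlen m, h, hSlen n]
    have hsum : ∀ {s : Set ℝ} {r : ℝ}, MeasurableSet s → 0 < r →
        (∀ n ∈ Finset.range (2 * N), ENNReal.ofReal (r / 2) ≤ ν (S n) s) →
        ENNReal.ofReal (N * r) ≤ μ s := by
      intro s r hs hr h
      rw [hμdef, Measure.sum_apply _ hs]
      calc ENNReal.ofReal (N * r) = ∑ n ∈ Finset.range (2 * N), ENNReal.ofReal (r / 2) := by
            rw [← ENNReal.ofReal_sum_of_nonneg fun _ _ => by positivity, Finset.sum_const,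
              Finset.card_range, nsmul_eq_mul]
            congr 1
            push_cast
            ring
        _ ≤ ∑ n ∈ Finset.range (2 * N), ν (S n) s := Finset.sum_le_sum h
        _ ≤ ∑' n, ν (S n) s := ENNReal.sum_le_tsum _
        _ ≤ ∑' σ, ν σ s := ENNReal.tsum_comp_le_tsum_of_injective hSinj _
    have hev : ∀ᶠ r in 𝓝[>] (0 : ℝ), ∀ n ∈ Finset.range (2 * N),
        ENNReal.ofReal (r / 2) ≤ ν (S n) (Ioo x (x + r)) ∧
        ENNReal.ofReal (r / 2) ≤ ν (S n) (Ioo (x - r) x) := by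
      refine (Finset.eventually_all _).2 fun n _ => ?_
      obtain ⟨δ, hδ, h⟩ := hlow (S n) x ⟨⟨hx, hSmem n⟩, hSleft n⟩
      filter_upwards [Ioo_mem_nhdsGT hδ] with r hr using h r hr.1 hr.2
    obtain ⟨δ, hδ, hδsub⟩ := (nhdsGT_basis (0 : ℝ)).eventually_iff.1 hev
    exact ⟨δ, hδ, fun r hr hrδ =>
      ⟨hsum measurableSet_Ioo hr fun n hn => (hδsub ⟨hr, hrδ⟩ n hn).1,
        hsum measurableSet_Ioo hr fun n hn => (hδsub ⟨hr, hrδ⟩ n hn).2⟩⟩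
  · obtain ⟨σ, hσ, hσl, hσm⟩ := exists_mem_hullSet_forall_cons_notMem hB hAB hx
    choose M hMt hM using fun τ => hup τ x
    have hSfin : {τ : List ℕ | τ <:+ σ}.Finite :=
      (List.finite_toSet σ.tails).subset fun τ hτ => (List.mem_tails τ σ).2 hτ
    set c : List ℕ → ENNReal := fun τ => {τ | τ <:+ σ}.indicator M τ + 4 * ε τ with hc
    have hct : ∑' τ, c τ ≠ ⊤ := by
      rw [hc, ENNReal.tsum_add, ENNReal.tsum_mul_left]
      refine ENNReal.add_ne_top.2 ⟨?_, ENNReal.mul_ne_top (by norm_num)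
        (hεsum.trans ENNReal.one_lt_top).ne⟩
      rw [tsum_eq_sum (s := hSfin.toFinset) fun τ hτ =>
        indicator_of_notMem (fun h => hτ (hSfin.mem_toFinset.2 h)) _]
      refine ENNReal.sum_ne_top.2 fun τ hτ => ?_
      rw [indicator_of_mem (hSfin.mem_toFinset.1 hτ)]
      exact hMt τ
    refine lipInf_measureReal_Iic_lt_top hμ hct fun δ hδ => ?_
    have hev : ∀ᶠ r in 𝓝[>] (0 : ℝ), ∀ τ ∈ {τ : List ℕ | τ <:+ σ},
        ν τ (ball x r) ≤ M τ * ENNReal.ofReal r := by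
      refine hSfin.eventually_all.2 fun τ _ => ?_
      obtain ⟨d, hd, h⟩ := hM τ
      filter_upwards [Ioo_mem_nhdsGT hd] with r hr using h r hr.1 hr.2
    obtain ⟨d, hd, hdsub⟩ := (nhdsGT_basis (0 : ℝ)).eventually_iff.1 hev
    obtain ⟨r, hr, hrδ, hrl, hrτ⟩ := exists_radius hB hσl hσm (lt_min hδ hd)
    refine ⟨r, hr, hrδ.trans_le (min_le_left _ _), ?_⟩
    rw [hμdef, Measure.sum_apply _ measurableSet_ball, ← ENNReal.tsum_mul_right]
    refine ENNReal.tsum_le_tsum fun τ => ?_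
    have hzero : Disjoint (ball x r) (hullSet A B τ) → ν τ (ball x r) ≤ c τ * ENNReal.ofReal r :=
      fun h => by
        rw [measure_mono_null (subset_compl_iff_disjoint_right.2 h) (hsupp τ)]
        exact zero_le
    have hclose : ∀ q ∈ leftSet A B τ, dist x q ≤ r →
        ν τ (ball x r) ≤ c τ * ENNReal.ofReal r := fun q hq hxq => by
      refine (measure_mono (ball_subset_ball' (show r + dist x q ≤ 2 * r by linarith))).trans
        ((hleft τ q hq (2 * r) (by linarith)).trans ?_)
      have he : (ε τ : ℝ) * (2 * (2 * r)) = 4 * ε τ * r := by ring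
      rw [he, ENNReal.ofReal_mul (by positivity), ENNReal.ofReal_mul (by norm_num),
        ENNReal.ofReal_coe_nnreal]
      gcongr
      norm_num [hc]
    rcases suffix_or_hullSet_subset_leftSet (A := A) (B := B) σ τ with h | h | h | ⟨j, h⟩
    · refine (hdsub ⟨hr, hrδ.trans_le (min_le_right _ _)⟩ τ h).trans ?_
      gcongr
      rw [hc]
      simp only
      rw [indicator_of_mem (show τ ∈ {τ | τ <:+ σ} from h)]
      exact le_self_add
    · exact hzero (hrl.mono_right h)
    · exact hclose x (h hσ) (by rw [dist_self]; exact hr.le)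
    · rcases hrτ τ j h with h | ⟨q, hq, hxq⟩
      · exact hzero h
      · exact hclose q hq hxq
end
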